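/- arXiv:1801.04956 — 8 statements merged into one kernel-verified Lean document; each statement's English description precedes it below -/
import Mathlib

section
/- Let I be the ideal of R generated by the five polynomials f1* = x3^{a13}x4^{a14}, f2* = x2^{a2}, f3* = x3^{a3}, f4* = x4^{a4}, f5* = x2^{a32}x4^{a14}. Then the sequence 0 → R^2 →(φ3) R^6 →(φ2) R^5 →(φ1) R → R/I → 0 is exact, and it is a minimal free resolution of R/I (every entry of the matrices φ1, φ2, φ3 lies in the maximal ideal (x1,x2,x3,x4)). Here φ1 is the row vector (x3^{a13}x4^{a14}, x2^{a2}, x3^{a3}, x4^{a4}, x2^{a32}x4^{a14}); φ2 is the 5×6 matrix with rows (x3^{a43}, 0, x4^{a24}, x2^{a32}, 0, 0), (0, x3^{a3}, 0, 0, 0, x4^{a14}), (−x4^{a14}, −x2^{a2}, 0, 0, 0, 0), (0, 0, −x3^{a13}, 0, x2^{a32}, 0), (0, 0, 0, −x3^{a13}, −x4^{a24}, −x2^{a42}); and φ3 is the 6×2 matrix with rows (x2^{a2}, 0), (−x4^{a14}, 0), (0, x2^{a32}), (−x2^{a42}x3^{a43}, −x4^{a24}), (0, x3^{a13}), (x3^{a3},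 0). -/
open MvPolynomial Matrix

theorem MvPolynomial.exists_eq_add_of_X_pow_mul_eq {σ R : Type*} [CommRing R] {i j l : σ}
    (hj : j ≠ i) (hl : l ≠ i) (p q r : ℕ) {a b c : MvPolynomial σ R}
    (h : X i ^ p * a = X j ^ q * b + X l ^ r * c) :
    ∃ s t, a = X j ^ q * s + X l ^ r * t := by
  classical
  have key : ∀ u : MvPolynomial σ R,
      (∃ s t, u = X j ^ q * s + X l ^ r * t) ↔
        ∀ e ∈ u.support, ∃ n ∈ ({Finsupp.single j q, Finsupp.single l r} : Set (σ →₀ ℕ)),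
          n ≤ e := by
    intro u
    rw [← mem_ideal_span_monomial_image, Set.image_pair, Ideal.mem_span_pair]
    simp only [← X_pow_eq_monomial]
    constructor
    · rintro ⟨s, t, rfl⟩
      exact ⟨s, t, by ring⟩
    · rintro ⟨s, t, rfl⟩
      exact ⟨s, t, by ring⟩
  have h' := (key _).1 ⟨b, c, h⟩
  refine (key a).2 fun e he => ?_
  obtain ⟨n, hn, hle⟩ := h' (Finsupp.single i p + e) (by
    rw [mem_support_iff] at he ⊢
    rwa [X_pow_eq_monomial, coeff_monomial_mul, one_mul])
  refine ⟨n, hn, fun x => ?_⟩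
  have hx := hle x
  rcases hn with rfl | rfl <;> by_cases hxi : x = i
  · subst hxi; simp [hj]
  · simpa [Ne.symm hxi] using hx
  · subst hxi; simp [hl]
  · simpa [Ne.symm hxi] using hx

theorem MvPolynomial.X_pow_dvd_of_X_pow_mul_eq {σ R : Type*} [CommRing R] {i j : σ}
    (hj : j ≠ i) (p q : ℕ) {a b : MvPolynomial σ R} (h : X i ^ p * a = X j ^ q * b) :
    ∃ s, a = X j ^ q * s := by
  obtain ⟨s, t, rfl⟩ := exists_eq_add_of_X_pow_mul_eq hj hj p q q (c := 0) (by simpa using h)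
  exact ⟨s + t, by ring⟩

theorem gorenstein_tangent_cone_resolution_case_1a_stmt0
    (k : Type*) [Field k]
    (a21 a31 a32 a42 a13 a43 a14 a24 a1 a2 a3 a4 : ℕ)
    (h21 : 0 < a21)
    (h31 : 0 < a31)
    (h32 : 0 < a32)
    (h42 : 0 < a42)
    (h13 : 0 < a13)
    (h43 : 0 < a43)
    (h14 : 0 < a14)
    (h24 : 0 < a24)
    (ha1 : a1 = a21 + a31)
    (ha2 : a2 = a32 + a42)
    (ha3 : a3 = a13 + a43)
    (ha4 : a4 = a14 + a24)
    (hc1 : a13 + a14 < a1)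
    (hc2 : a4 < a42 + a43)
    (hc3 : a3 < a31 + a32)
    (hc4 : a2 ≤ a21 + a24)
    (x1 x2 x3 x4 : MvPolynomial (Fin 4) k)
    (hx1 : x1 = X 0) (hx2 : x2 = X 1) (hx3 : x3 = X 2) (hx4 : x4 = X 3)
    (I m : Ideal (MvPolynomial (Fin 4) k))
    (hI : I = Ideal.span {x3 ^ a13 * x4 ^ a14, x2 ^ a2, x3 ^ a3, x4 ^ a4, x2 ^ a32 * x4 ^ a14})
    (hm : m = Ideal.span {x1, x2, x3, x4})
    (g : Fin 5 → MvPolynomial (Fin 4) k)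
    (hg : g = ![x3 ^ a13 * x4 ^ a14, x2 ^ a2, x3 ^ a3, x4 ^ a4, x2 ^ a32 * x4 ^ a14])
    (φ1 : (Fin 5 → MvPolynomial (Fin 4) k) →ₗ[MvPolynomial (Fin 4) k]
      MvPolynomial (Fin 4) k)
    (hφ1 : ∀ v, φ1 v = ∑ i, v i * g i)
    (M2 : Matrix (Fin 5) (Fin 6) (MvPolynomial (Fin 4) k))
    (hM2 : M2 = !![x3 ^ a43, 0, x4 ^ a24, x2 ^ a32, 0, 0;
      0, x3 ^ a3, 0, 0, 0, x4 ^ a14;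
      -x4 ^ a14, -x2 ^ a2, 0, 0, 0, 0;
      0, 0, -x3 ^ a13, 0, x2 ^ a32, 0;
      0, 0, 0, -x3 ^ a13, -x4 ^ a24, -x2 ^ a42])
    (M3 : Matrix (Fin 6) (Fin 2) (MvPolynomial (Fin 4) k))
    (hM3 : M3 = !![x2 ^ a2, 0;
      -x4 ^ a14, 0;
      0, x2 ^ a32;
      -(x2 ^ a42 * x3 ^ a43), -x4 ^ a24;
      0, x3 ^ a13;
      x3 ^ a3, 0]) :
    Function.Injective ⇑M3.mulVecLin ∧
    Function.Exact ⇑M3.mulVecLin ⇑M2.mulVecLin ∧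
    Function.Exact ⇑M2.mulVecLin ⇑φ1 ∧
    LinearMap.range φ1 = I ∧
    Function.Surjective (Ideal.Quotient.mk I) ∧
    (∀ i, g i ∈ m) ∧ (∀ i j, M2 i j ∈ m) ∧ (∀ i j, M3 i j ∈ m) := by
  subst ha2 ha3 ha4 hx1 hx2 hx3 hx4
  have n2 : ∀ n, (X 1 : MvPolynomial (Fin 4) k) ^ n ≠ 0 := fun n => pow_ne_zero _ (X_ne_zero _)
  have n3 : ∀ n, (X 2 : MvPolynomial (Fin 4) k) ^ n ≠ 0 := fun n => pow_ne_zero _ (X_ne_zero _)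
  have n4 : ∀ n, (X 3 : MvPolynomial (Fin 4) k) ^ n ≠ 0 := fun n => pow_ne_zero _ (X_ne_zero _)
  have m3 : ∀ v, M3 *ᵥ v = ![X 1 ^ (a32 + a42) * v 0, -X 3 ^ a14 * v 0, X 1 ^ a32 * v 1,
      -(X 1 ^ a42 * X 2 ^ a43) * v 0 + -X 3 ^ a24 * v 1, X 2 ^ a13 * v 1,
      X 2 ^ (a13 + a43) * v 0] := by
    intro v
    subst hM3
    ext1 i
    fin_cases i <;> simp [mulVec, dotProduct, Fin.sum_univ_succ]
  have m2 : ∀ w, M2 *ᵥ w = ![X 2 ^ a43 * w 0 + X 3 ^ a24 * w 2 + X 1 ^ a32 * w 3,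
      X 2 ^ (a13 + a43) * w 1 + X 3 ^ a14 * w 5,
      -(X 3 ^ a14 * w 0 + X 1 ^ (a32 + a42) * w 1),
      X 1 ^ a32 * w 4 - X 2 ^ a13 * w 2,
      -(X 2 ^ a13 * w 3 + X 3 ^ a24 * w 4 + X 1 ^ a42 * w 5)] := by
    intro w
    subst hM2
    ext1 i
    fin_cases i <;> simp [mulVec, dotProduct, Fin.sum_univ_succ] <;> ring
  have m1 : ∀ v, φ1 v = v 0 * (X 2 ^ a13 * X 3 ^ a14) + v 1 * X 1 ^ (a32 + a42)
      + v 2 * X 2 ^ (a13 + a43) + v 3 * X 3 ^ (a14 + a24) + v 4 * (X 1 ^ a32 * X 3 ^ a14) := by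
    intro v
    rw [hφ1, hg]
    simp [Fin.sum_univ_succ]
    ring
  refine ⟨?_, ?_, ?_, ?_, Ideal.Quotient.mk_surjective, ?_⟩
  · rw [injective_iff_map_eq_zero]
    intro v hv
    rw [mulVecLin_apply, m3] at hv
    have e0 := congrFun hv 0
    have e2 := congrFun hv 2
    simp at e0 e2
    ext1 i
    fin_cases i
    · exact e0
    · exact e2
  · intro w
    simp only [mulVecLin_apply, Set.mem_range]
    constructor
    · intro hw
      rw [m2] at hw
      have r1 := congrFun hw 1
      have r2 := congrFun hw 2
      have r3 := congrFun hw 3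
      have r4 := congrFun hw 4
      simp only [Matrix.cons_val, Pi.zero_apply] at r1 r2 r3 r4
      obtain ⟨u, hu⟩ := X_pow_dvd_of_X_pow_mul_eq (R := k) (i := (1 : Fin 4)) (j := 3)
        (by decide) (a32 + a42) a14 (a := w 1) (b := -w 0) (by linear_combination -r2)
      obtain ⟨v, hv⟩ := X_pow_dvd_of_X_pow_mul_eq (R := k) (i := (1 : Fin 4)) (j := 2)
        (by decide) a32 a13 (a := w 4) (b := w 2) (by linear_combination r3)
      have h0 : w 0 = -(X 1 ^ (a32 + a42) * u) := by
        apply mul_left_cancel₀ (n4 a14)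
        rw [hu] at r2
        linear_combination -r2
      have h5 : w 5 = -(X 2 ^ (a13 + a43) * u) := by
        apply mul_left_cancel₀ (n4 a14)
        rw [hu] at r1
        linear_combination r1
      have h2 : w 2 = X 1 ^ a32 * v := by
        apply mul_left_cancel₀ (n3 a13)
        rw [hv] at r3
        linear_combination -r3
      have h3 : w 3 = X 1 ^ a42 * X 2 ^ a43 * u - X 3 ^ a24 * v := by
        apply mul_left_cancel₀ (n3 a13)
        rw [hv, h5] at r4
        linear_combination -r4
      refine ⟨![-u, v], ?_⟩
      rw [m3]
      ext1 i
      fin_cases i <;> simp [h0, hu, h2, h3, hv, h5]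
      ring
    · rintro ⟨v, rfl⟩
      rw [m2, m3]
      ext1 i
      fin_cases i <;> simp <;> ring
  · intro v
    simp only [mulVecLin_apply, Set.mem_range]
    constructor
    · intro hv
      rw [m1] at hv
      obtain ⟨s, t, h1⟩ := exists_eq_add_of_X_pow_mul_eq (R := k) (i := (1 : Fin 4)) (j := 2)
        (l := 3) (by decide) (by decide) (a32 + a42) (a13 + a43) a14 (a := v 1) (b := -v 2)
        (c := -(v 0 * X 2 ^ a13 + v 3 * X 3 ^ a24 + v 4 * X 1 ^ a32))
        (by linear_combination hv)
      obtain ⟨r, h2⟩ := X_pow_dvd_of_X_pow_mul_eq (R := k) (i := (2 : Fin 4)) (j := 3)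
        (by decide) (a13 + a43) a14 (a := v 2 + X 1 ^ (a32 + a42) * s)
        (b := -(v 0 * X 2 ^ a13 + v 3 * X 3 ^ a24 + v 4 * X 1 ^ a32 + X 1 ^ (a32 + a42) * t))
        (by rw [h1] at hv; linear_combination hv)
      have h2' : v 2 = X 3 ^ a14 * r - X 1 ^ (a32 + a42) * s := by linear_combination h2
      have hv' : X 2 ^ a13 * (v 0 + X 2 ^ a43 * r) + X 3 ^ a24 * v 3
          + X 1 ^ a32 * (v 4 + X 1 ^ a42 * t) = 0 := by
        apply mul_left_cancel₀ (n4 a14)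
        rw [h1, h2'] at hv
        linear_combination hv
      obtain ⟨p, q, h4⟩ := exists_eq_add_of_X_pow_mul_eq (R := k) (i := (1 : Fin 4)) (j := 2)
        (l := 3) (by decide) (by decide) a32 a13 a24 (a := v 4 + X 1 ^ a42 * t)
        (b := -(v 0 + X 2 ^ a43 * r)) (c := -v 3) (by linear_combination hv')
      rw [h4] at hv'
      obtain ⟨o, h3⟩ := X_pow_dvd_of_X_pow_mul_eq (R := k) (i := (3 : Fin 4)) (j := 2)
        (by decide) a24 a13 (a := v 3 + X 1 ^ a32 * q)
        (b := -(v 0 + X 2 ^ a43 * r + X 1 ^ a32 * p)) (by linear_combination hv')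
      have h0 : v 0 = -(X 2 ^ a43 * r) - X 3 ^ a24 * o - X 1 ^ a32 * p := by
        apply mul_left_cancel₀ (n3 a13)
        linear_combination hv' - X 3 ^ a24 * h3
      refine ⟨![-r, s, -o, -p, -q, t], ?_⟩
      rw [m2]
      ext1 i
      fin_cases i <;> simp
      · linear_combination -h0
      · linear_combination -h1
      · linear_combination -h2
      · linear_combination -h3
      · linear_combination -h4
    · rintro ⟨w, rfl⟩
      rw [m1, m2]
      simp
      ring
  · have hI' : I = Ideal.span (Set.range g) := by
      rw [hI, hg]
      congr 1
      simp only [Matrix.range_cons, Matrix.range_empty, Set.union_empty, Set.singleton_union]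
    rw [hI']
    ext y
    rw [Ideal.mem_span_range_iff_exists_fun, LinearMap.mem_range]
    simp only [hφ1]
  · have e2 : (X 1 : MvPolynomial (Fin 4) k) ∈ m := by
      rw [hm]; exact Ideal.subset_span (by simp)
    have e3 : (X 2 : MvPolynomial (Fin 4) k) ∈ m := by
      rw [hm]; exact Ideal.subset_span (by simp)
    have e4 : (X 3 : MvPolynomial (Fin 4) k) ∈ m := by
      rw [hm]; exact Ideal.subset_span (by simp)
    have p2 : ∀ n, 0 < n → (X 1 : MvPolynomial (Fin 4) k) ^ n ∈ m :=
      fun n hn => Ideal.pow_mem_of_mem m e2 n hn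
    have p3 : ∀ n, 0 < n → (X 2 : MvPolynomial (Fin 4) k) ^ n ∈ m :=
      fun n hn => Ideal.pow_mem_of_mem m e3 n hn
    have p4 : ∀ n, 0 < n → (X 3 : MvPolynomial (Fin 4) k) ^ n ∈ m :=
      fun n hn => Ideal.pow_mem_of_mem m e4 n hn
    refine ⟨fun i => ?_, fun i j => ?_, fun i j => ?_⟩
    · rw [hg]
      fin_cases i <;> simp [p2, p3, p4, h32, h13, h14, Ideal.mul_mem_left]
    · rw [hM2]
      fin_cases i <;> fin_cases j <;> simp [p2, p3, p4, h32, h42, h13, h43, h14, h24]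
    · rw [hM3]
      fin_cases i <;> fin_cases j <;>
        simp [p2, p3, p4, h32, h13, h43, h14, h24, Ideal.mul_mem_left]
end

section
/- Let I be the ideal of R generated by the five polynomials f1* = x3^{a13}x4^{a14}, f2 = x2^{a2} − x1^{a21}x4^{a24}, f3* = x3^{a3}, f4* = x4^{a4}, f5* = x2^{a32}x4^{a14}. Then the sequence 0 → R^2 →(φ3) R^6 →(φ2) R^5 →(φ1) R → R/I → 0 is exact, and it is a minimal free resolution of R/I. Here φ1 = (x3^{a13}x4^{a14}, x2^{a2}−x1^{a21}x4^{a24}, x3^{a3}, x4^{a4}, x2^{a32}x4^{a14}); φ2 is the 5×6 matrix with rows (x4^{a24}, x2^{a32}, x3^{a43}, 0, 0, 0), (0, 0, 0, x4^{a14}, 0, x3^{a3}), (0, 0, −x4^{a14}, 0, 0, −x2^{a2}+x1^{a21}x4^{a24}), (−x3^{a13}, 0, 0, x1^{a21}, x2^{a32}, 0), (0, −x3^{a13}, 0, −x2^{a42}, −x4^{a24}, 0); and φ3 is the 6×2 matrix with rows (x2^{a32}, x1^{a21}x3^{a43}), (−x4^{a24}, −x2^{a42}x3^{a43}), (0, x2^{a2}−x1^{a21}x4^{a24}),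 (0, x3^{a3}), (x3^{a13}, 0), (0, −x4^{a14}). -/
open MvPolynomial Matrix

/-- A variable not occurring in the generators of a monomial ideal is regular modulo that ideal. -/
theorem mem_span_monomial_of_mul_X_pow_mem {σ k : Type*} [Field k] {S : Set (σ →₀ ℕ)} {l : σ}
    (hS : ∀ s ∈ S, s l = 0) (n : ℕ) {p : MvPolynomial σ k}
    (h : p * X l ^ n ∈ Ideal.span ((fun s => monomial s (1 : k)) '' S)) :
    p ∈ Ideal.span ((fun s => monomial s (1 : k)) '' S) := by
  classical
  rw [mem_ideal_span_monomial_image] at h ⊢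
  intro m hm
  obtain ⟨s, hs, hle⟩ := h (m + Finsupp.single l n) (by
    rw [mem_support_iff] at hm ⊢
    rwa [X_pow_eq_monomial, coeff_mul_monomial, mul_one])
  refine ⟨s, hs, fun i => ?_⟩
  by_cases hi : i = l
  · subst hi
    simp [hS s hs]
  · have := hle i
    rwa [Finsupp.add_apply, Finsupp.single_eq_of_ne hi, add_zero] at this

theorem mem_span_X_pow_pair_of_mul_X_pow_mem {σ k : Type*} [Field k] {i j l : σ}
    (hi : i ≠ l) (hj : j ≠ l) (a b n : ℕ) {p : MvPolynomial σ k}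
    (h : p * X l ^ n ∈ Ideal.span {(X i ^ a : MvPolynomial σ k), X j ^ b}) :
    p ∈ Ideal.span {(X i ^ a : MvPolynomial σ k), X j ^ b} := by
  have key := mem_span_monomial_of_mul_X_pow_mem (k := k) (l := l)
    (S := {Finsupp.single i a, Finsupp.single j b}) (by
      rintro s (rfl | rfl)
      · exact Finsupp.single_eq_of_ne hi.symm
      · exact Finsupp.single_eq_of_ne hj.symm) n (p := p)
  simp only [Set.image_pair, ← X_pow_eq_monomial] at key
  exact key h

theorem X_pow_dvd_of_dvd_mul_X_pow {σ k : Type*} [Field k] {i l : σ}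
    (hi : i ≠ l) (a n : ℕ) {p : MvPolynomial σ k}
    (h : (X i ^ a : MvPolynomial σ k) ∣ p * X l ^ n) : (X i ^ a : MvPolynomial σ k) ∣ p := by
  have key := mem_span_X_pow_pair_of_mul_X_pow_mem hi hi a a n (p := p)
  simp only [Set.pair_eq_singleton, Ideal.mem_span_singleton] at key
  exact key h

/-- If `y` is regular modulo `J` and `u` is nilpotent modulo `J`, then `y - u` is regular
modulo `J`. -/
theorem Ideal.mem_of_mul_sub_mem {R : Type*} [CommRing R] {J : Ideal R} {y u : R} {N : ℕ}
    (hy : ∀ p, p * y ∈ J → p ∈ J) (hu : u ^ N ∈ J) {p : R} (h : p * (y - u) ∈ J) : p ∈ J := by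
  have h1 : p * y ^ N ∈ J := by
    obtain ⟨c, hc⟩ := sub_dvd_pow_sub_pow y u N
    have : p * y ^ N = c * (p * (y - u)) + p * u ^ N := by linear_combination p * hc
    rw [this]
    exact J.add_mem (J.mul_mem_left _ h) (J.mul_mem_left _ hu)
  clear hu
  induction N with
  | zero => simpa using h1
  | succ n ih => exact ih (hy _ (by rwa [mul_assoc, ← pow_succ]))

section Complex

variable {R : Type*} [CommRing R] [IsDomain R] {A B Y Y' P Q W : R}

theorem firstSyzygy_exact
    (hBPQ : ∀ p, B ∣ p * (P * Q) → B ∣ p) (hAY : ∀ p, A ∣ p * Y → A ∣ p)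
    (hP : ∀ p, p * P ∈ Ideal.span {A, Y} → p ∈ Ideal.span {A, Y})
    (hF : ∀ p, p * (Y * Y' - W * A) ∈ Ideal.span {P * Q, B} → p ∈ Ideal.span {P * Q, B})
    (hA0 : A ≠ 0) (hB0 : B ≠ 0) {v1 v2 v3 v4 v5 : R}
    (h : v1 * (P * B) + v2 * (Y * Y' - W * A) + v3 * (P * Q) + v4 * (A * B) + v5 * (Y * B) = 0) :
    ∃ u1 u2 u3 u4 u5 u6 : R,
      v1 = A * u1 + Y * u2 + Q * u3 ∧ v2 = B * u4 + P * Q * u6 ∧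
      v3 = -B * u3 + (-(Y * Y') + W * A) * u6 ∧ v4 = -P * u1 + W * u4 + Y * u5 ∧
      v5 = -P * u2 + -Y' * u4 + -A * u5 := by
  obtain ⟨c, d, hcd⟩ := Ideal.mem_span_pair.1 (hF v2 (Ideal.mem_span_pair.2
    ⟨-v3, -(v1 * P + v4 * A + v5 * Y), by linear_combination -h⟩))
  obtain ⟨e, he⟩ := hBPQ (v3 + c * (Y * Y' - W * A))
    ⟨-(v1 * P + v4 * A + v5 * Y) - d * (Y * Y' - W * A), by
      linear_combination h + (Y * Y' - W * A) * hcd⟩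
  have h2 : (v1 + e * Q) * P + (v4 - d * W) * A + (v5 + d * Y') * Y = 0 := by
    apply mul_left_cancel₀ hB0
    linear_combination h + (Y * Y' - W * A) * hcd - P * Q * he
  obtain ⟨α, β, hαβ⟩ := Ideal.mem_span_pair.1 (hP (v1 + e * Q) (Ideal.mem_span_pair.2
    ⟨-(v4 - d * W), -(v5 + d * Y'), by linear_combination -h2⟩))
  obtain ⟨γ, hγ⟩ := hAY (v5 + d * Y' + β * P) ⟨-(v4 - d * W + α * P), by
    linear_combination h2 + P * hαβ⟩
  have h3 : v4 - d * W + α * P = -(γ * Y) := by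
    apply mul_left_cancel₀ hA0
    linear_combination h2 + P * hαβ - Y * hγ
  refine ⟨α, β, -e, d, -γ, c, ?_, ?_, ?_, ?_, ?_⟩
  · linear_combination -hαβ
  · linear_combination -hcd
  · linear_combination he
  · linear_combination h3
  · linear_combination hγ

theorem secondSyzygy_exact
    (hBPQ : ∀ p, B ∣ p * (P * Q) → B ∣ p) (hAY : ∀ p, A ∣ p * Y → A ∣ p)
    (hA0 : A ≠ 0) (hB0 : B ≠ 0) (hY0 : Y ≠ 0) {u1 u2 u3 u4 u5 u6 : R}
    (h1 : A * u1 + Y * u2 + Q * u3 = 0) (h2 : B * u4 + P * Q * u6 = 0)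
    (h3 : -B * u3 + (-(Y * Y') + W * A) * u6 = 0) (h4 : -P * u1 + W * u4 + Y * u5 = 0) :
    ∃ s t : R, u1 = Y * s + W * Q * t ∧ u2 = -A * s + -(Y' * Q) * t ∧
      u3 = (Y * Y' - W * A) * t ∧ u4 = P * Q * t ∧ u5 = P * s ∧ u6 = -B * t := by
  obtain ⟨t, ht⟩ := hBPQ u6 ⟨-u4, by linear_combination h2⟩
  have h4' : u4 = -(P * Q * t) := by
    apply mul_left_cancel₀ hB0
    linear_combination h2 - P * Q * ht
  have h3' : u3 = -((Y * Y' - W * A) * t) := by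
    apply mul_left_cancel₀ hB0
    linear_combination -h3 - (Y * Y' - W * A) * ht
  obtain ⟨s, hs⟩ := hAY (u2 - Y' * Q * t) ⟨-(u1 + W * Q * t), by
    linear_combination h1 - Q * h3'⟩
  have h1' : u1 = -(Y * s) - W * Q * t := by
    apply mul_left_cancel₀ hA0
    linear_combination h1 - Q * h3' - Y * hs
  refine ⟨-s, -t, ?_, ?_, ?_, ?_, ?_, ?_⟩
  · linear_combination h1'
  · linear_combination hs
  · linear_combination h3'
  · linear_combination h4'
  · apply mul_left_cancel₀ hY0
    linear_combination h4 + P * h1' - W * h4'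
  · linear_combination ht

end Complex

theorem gorenstein_tangent_cone_resolution_case_1a_stmt1
    (k : Type*) [Field k]
    (a21 a31 a32 a42 a13 a43 a14 a24 a1 a2 a3 a4 : ℕ)
    (h21 : 0 < a21)
    (h31 : 0 < a31)
    (h32 : 0 < a32)
    (h42 : 0 < a42)
    (h13 : 0 < a13)
    (h43 : 0 < a43)
    (h14 : 0 < a14)
    (h24 : 0 < a24)
    (ha1 : a1 = a21 + a31)
    (ha2 : a2 = a32 + a42)
    (ha3 : a3 = a13 + a43)
    (ha4 : a4 = a14 + a24)
    (hc1 : a13 + a14 < a1)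
    (hc2 : a4 < a42 + a43)
    (hc3 : a3 < a31 + a32)
    (hc4 : a2 ≤ a21 + a24)
    (x1 x2 x3 x4 : MvPolynomial (Fin 4) k)
    (hx1 : x1 = X 0) (hx2 : x2 = X 1) (hx3 : x3 = X 2) (hx4 : x4 = X 3)
    (I m : Ideal (MvPolynomial (Fin 4) k))
    (hI : I = Ideal.span {x3 ^ a13 * x4 ^ a14, x2 ^ a2 - x1 ^ a21 * x4 ^ a24, x3 ^ a3, x4 ^ a4, x2 ^ a32 * x4 ^ a14})
    (hm : m = Ideal.span {x1, x2, x3, x4})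
    (g : Fin 5 → MvPolynomial (Fin 4) k)
    (hg : g = ![x3 ^ a13 * x4 ^ a14, x2 ^ a2 - x1 ^ a21 * x4 ^ a24, x3 ^ a3, x4 ^ a4, x2 ^ a32 * x4 ^ a14])
    (φ1 : (Fin 5 → MvPolynomial (Fin 4) k) →ₗ[MvPolynomial (Fin 4) k]
      MvPolynomial (Fin 4) k)
    (hφ1 : ∀ v, φ1 v = ∑ i, v i * g i)
    (M2 : Matrix (Fin 5) (Fin 6) (MvPolynomial (Fin 4) k))
    (hM2 : M2 = !![x4 ^ a24, x2 ^ a32, x3 ^ a43, 0, 0, 0;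
      0, 0, 0, x4 ^ a14, 0, x3 ^ a3;
      0, 0, -x4 ^ a14, 0, 0, -x2 ^ a2 + x1 ^ a21 * x4 ^ a24;
      -x3 ^ a13, 0, 0, x1 ^ a21, x2 ^ a32, 0;
      0, -x3 ^ a13, 0, -x2 ^ a42, -x4 ^ a24, 0])
    (M3 : Matrix (Fin 6) (Fin 2) (MvPolynomial (Fin 4) k))
    (hM3 : M3 = !![x2 ^ a32, x1 ^ a21 * x3 ^ a43;
      -x4 ^ a24, -(x2 ^ a42 * x3 ^ a43);
      0, x2 ^ a2 - x1 ^ a21 * x4 ^ a24;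
      0, x3 ^ a3;
      x3 ^ a13, 0;
      0, -x4 ^ a14]) :
    Function.Injective ⇑M3.mulVecLin ∧
    Function.Exact ⇑M3.mulVecLin ⇑M2.mulVecLin ∧
    Function.Exact ⇑M2.mulVecLin ⇑φ1 ∧
    LinearMap.range φ1 = I ∧
    Function.Surjective (Ideal.Quotient.mk I) ∧
    (∀ i, g i ∈ m) ∧ (∀ i j, M2 i j ∈ m) ∧ (∀ i j, M3 i j ∈ m) := by
  have hφ : φ1 = Fintype.linearCombination (MvPolynomial (Fin 4) k) g :=
    LinearMap.ext fun v => (hφ1 v).trans rfl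
  subst hx1 hx2 hx3 hx4 ha1 ha2 ha3 ha4 hI hm hg hM2 hM3
  have hX0 : ∀ (i : Fin 4) (n : ℕ), (X i ^ n : MvPolynomial (Fin 4) k) ≠ 0 :=
    fun i n => pow_ne_zero _ (X_ne_zero i)
  have hBPQ : ∀ p : MvPolynomial (Fin 4) k,
      X 3 ^ a14 ∣ p * (X 2 ^ a13 * X 2 ^ a43) → X 3 ^ a14 ∣ p := by
    intro p h
    rw [← pow_add] at h
    exact X_pow_dvd_of_dvd_mul_X_pow (by decide) _ _ h
  have hAY : ∀ p : MvPolynomial (Fin 4) k, X 3 ^ a24 ∣ p * X 1 ^ a32 → X 3 ^ a24 ∣ p :=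
    fun p h => X_pow_dvd_of_dvd_mul_X_pow (by decide) _ _ h
  have hP : ∀ p : MvPolynomial (Fin 4) k,
      p * X 2 ^ a13 ∈ Ideal.span {X 3 ^ a24, X 1 ^ a32} →
        p ∈ Ideal.span {X 3 ^ a24, X 1 ^ a32} :=
    fun p h => mem_span_X_pow_pair_of_mul_X_pow_mem (by decide) (by decide) _ _ _ h
  have hF : ∀ p : MvPolynomial (Fin 4) k,
      p * (X 1 ^ a32 * X 1 ^ a42 - X 0 ^ a21 * X 3 ^ a24) ∈
          Ideal.span {X 2 ^ a13 * X 2 ^ a43, X 3 ^ a14} →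
        p ∈ Ideal.span {X 2 ^ a13 * X 2 ^ a43, X 3 ^ a14} := by
    intro p
    rw [← pow_add, ← pow_add]
    refine Ideal.mem_of_mul_sub_mem (N := a14)
      (fun q hq => mem_span_X_pow_pair_of_mul_X_pow_mem (by decide) (by decide) _ _ _ hq) ?_
    rw [mul_pow, ← pow_mul (X 3)]
    refine Ideal.mul_mem_left _ _ (Ideal.mem_of_dvd _ (pow_dvd_pow (X 3) (Nat.le_mul_of_pos_left a14 h24))
      (Ideal.subset_span (by simp)))
  have hmX : ∀ (i : Fin 4) (n : ℕ), 0 < n → (X i ^ n : MvPolynomial (Fin 4) k) ∈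
      Ideal.span {X 0, X 1, X 2, X 3} := by
    intro i n hn
    refine Ideal.pow_mem_of_mem _ (Ideal.subset_span ?_) n hn
    fin_cases i <;> simp
  refine ⟨?_, ?_, ?_, ?_, Ideal.Quotient.mk_surjective, ?_, ?_, ?_⟩
  · rw [injective_iff_map_eq_zero]
    intro v hv
    have e4 := congrFun hv 4
    have e5 := congrFun hv 5
    simp [mulVec, dotProduct, Fin.sum_univ_succ] at e4 e5
    funext i
    fin_cases i
    · simpa using e4
    · simpa using e5
  · intro u
    constructor
    · intro hu
      have e0 := congrFun hu 0
      have e1 := congrFun hu 1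
      have e2 := congrFun hu 2
      have e3 := congrFun hu 3
      simp [mulVec, dotProduct, Fin.sum_univ_six, pow_add] at e0 e1 e2 e3
      obtain ⟨s, t, r0, r1, r2, r3, r4, r5⟩ := secondSyzygy_exact (Y' := X 1 ^ a42)
        (W := X 0 ^ a21) (P := X 2 ^ a13) (u5 := u 4) hBPQ hAY (hX0 _ _) (hX0 _ _)
        (hX0 _ _) e0 e1
        (by linear_combination e2) (by linear_combination e3)
      refine ⟨![s, t], ?_⟩
      funext i
      fin_cases i <;> simp [mulVec, dotProduct, Fin.sum_univ_two, pow_add, r0, r1, r2, r3, r4, r5]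
    · rintro ⟨v, rfl⟩
      funext i
      fin_cases i <;>
        simp [mulVec, dotProduct, Fin.sum_univ_two, Fin.sum_univ_six, pow_add] <;> ring
  · intro v
    rw [hφ1]
    constructor
    · intro hv
      simp [Fin.sum_univ_five, pow_add] at hv
      obtain ⟨u1, u2, u3, u4, u5, u6, r0, r1, r2, r3, r4⟩ := firstSyzygy_exact
        hBPQ hAY hP hF (hX0 _ _) (hX0 _ _) (v1 := v 0) (v2 := v 1) (v3 := v 2) (v4 := v 3)
        (v5 := v 4) (by linear_combination hv)
      refine ⟨![u1, u2, u3, u4, u5, u6], ?_⟩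
      funext i
      fin_cases i <;> simp [mulVec, dotProduct, Fin.sum_univ_six, pow_add, r0, r1, r2, r3, r4]
    · rintro ⟨u, rfl⟩
      simp [mulVec, dotProduct, Fin.sum_univ_five, Fin.sum_univ_six, pow_add]
      ring
  · rw [hφ, Fintype.range_linearCombination]
    simp only [Matrix.range_cons, Matrix.range_empty, Set.union_empty, Set.singleton_union,
      Ideal.span]
  · intro i
    fin_cases i
    · exact Ideal.mul_mem_left _ _ (hmX _ _ h14)
    · exact Ideal.sub_mem _ (hmX _ _ (by omega)) (Ideal.mul_mem_left _ _ (hmX _ _ h24))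
    · exact hmX _ _ (by omega)
    · exact hmX _ _ (by omega)
    · exact Ideal.mul_mem_left _ _ (hmX _ _ h14)
  · intro i j
    have hF' := Ideal.add_mem _ ((Ideal.neg_mem_iff _).2 (hmX 1 (a32 + a42) (by omega)))
      (Ideal.mul_mem_left _ (X 0 ^ a21) (hmX 3 a24 h24))
    have hPQ := hmX 2 (a13 + a43) (by omega)
    fin_cases i <;> fin_cases j <;> simp [*]
  · intro i j
    have hF' := Ideal.sub_mem _ (hmX 1 (a32 + a42) (by omega))
      (Ideal.mul_mem_left _ (X 0 ^ a21) (hmX 3 a24 h24))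
    have hPQ := hmX 2 (a13 + a43) (by omega)
    have hQ := fun p => Ideal.mul_mem_left _ p (hmX 2 a43 h43)
    fin_cases i <;> fin_cases j <;> simp [*]
end

section
/- Let I be the ideal of R generated by x3^{a13}x4^{a14}, x2^{a2}, x3^{a3}, x4^{a4}, x2^{a42}x3^{a13}. Then the sequence 0 → R^2 →(φ3) R^6 →(φ2) R^5 →(φ1) R → R/I → 0 is exact, and it is a minimal free resolution of R/I. Here φ1 = (x3^{a13}x4^{a14}, x2^{a2}, x3^{a3}, x4^{a4}, x2^{a42}x3^{a13}); φ2 is the 5×6 matrix with rows (−x4^{a34}, 0, −x3^{a23}, 0, x2^{a42}, 0), (0, −x4^{a4}, 0, 0, 0, −x3^{a13}), (0, 0, x4^{a14}, x2^{a42}, 0, 0), (x3^{a13}, x2^{a2}, 0, 0, 0, 0), (0, 0, 0, −x3^{a23}, −x4^{a14}, x2^{a32}); and φ3 is the 6×2 matrix with rows (x2^{a2}, 0), (−x3^{a13}, 0), (0, x2^{a42}), (0, −x4^{a14}), (x2^{a32}x4^{a34}, x3^{a23}), (x4^{a4}, 0). -/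
open MvPolynomial Matrix

section RegularPowers

variable {σ k : Type*} [Field k]

/-- A power of a variable is a nonzerodivisor modulo powers of two other variables. -/
theorem MvPolynomial.exists_eq_add_of_X_pow_mul {i j l : σ} (hil : i ≠ l) (hjl : j ≠ l)
    (a b c : ℕ) {t u v : MvPolynomial σ k}
    (h : t * X l ^ c = u * X i ^ a + v * X j ^ b) :
    ∃ α β, t = α * X i ^ a + β * X j ^ b := by
  classical
  have key : ∀ p : MvPolynomial σ k, (∃ α β, α * X i ^ a + β * X j ^ b = p) ↔
      ∀ d ∈ p.support, a ≤ d i ∨ b ≤ d j := by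
    intro p
    have := mem_ideal_span_monomial_image (R := k) (x := p)
      (s := {Finsupp.single i a, Finsupp.single j b})
    rw [Set.image_pair, Ideal.mem_span_pair] at this
    simpa [X_pow_eq_monomial, Finsupp.single_le_iff] using this
  have hmul := (key _).1 ⟨u, v, h.symm⟩
  obtain ⟨α, β, e⟩ := (key t).2 fun d hd => by
    have := hmul (d + Finsupp.single l c) (by
      rw [mem_support_iff, X_pow_eq_monomial, coeff_mul_monomial, mul_one]
      exact mem_support_iff.1 hd)
    simpa [Finsupp.single_apply, hil.symm, hjl.symm] using this
  exact ⟨α, β, e.symm⟩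

theorem MvPolynomial.exists_eq_mul_of_X_pow_mul_add_eq_zero {i j : σ} (hij : i ≠ j) (a b : ℕ)
    {u v : MvPolynomial σ k} (h : u * X i ^ a + v * X j ^ b = 0) :
    ∃ γ, u = γ * X j ^ b ∧ v = -(γ * X i ^ a) := by
  obtain ⟨α, β, e⟩ := exists_eq_add_of_X_pow_mul (i := j) (j := j) (u := -v) (v := 0)
    hij.symm hij.symm b b a (by linear_combination h : u * X i ^ a = _)
  refine ⟨α + β, by rw [e]; ring, ?_⟩
  have hX : (X j ^ b : MvPolynomial σ k) ≠ 0 := pow_ne_zero _ (X_ne_zero j)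
  apply mul_right_cancel₀ hX
  rw [e] at h
  linear_combination h

/-- The Koszul relations generate all syzygies of powers of three distinct variables. -/
theorem MvPolynomial.exists_koszul_of_X_pow_mul_add_eq_zero {i j l : σ} (hij : i ≠ j)
    (hil : i ≠ l) (hjl : j ≠ l) (a b c : ℕ) {u v t : MvPolynomial σ k}
    (h : u * X i ^ a + v * X j ^ b + t * X l ^ c = 0) :
    ∃ α β γ, u = γ * X j ^ b - α * X l ^ c ∧ v = -(γ * X i ^ a) - β * X l ^ c ∧
      t = α * X i ^ a + β * X j ^ b := by
  obtain ⟨α, β, e⟩ := exists_eq_add_of_X_pow_mul (u := -u) (v := -v) hil hjl a b c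
    (by linear_combination h : t * X l ^ c = _)
  obtain ⟨γ, h₁, h₂⟩ := exists_eq_mul_of_X_pow_mul_add_eq_zero hij a b
    (u := u + α * X l ^ c) (v := v + β * X l ^ c) (by rw [e] at h; linear_combination h)
  exact ⟨α, β, γ, by linear_combination h₁, by linear_combination h₂, e⟩

end RegularPowers

open MvPolynomial Matrix

theorem gorenstein_tangent_cone_resolution_case_1b_stmt2
    (k : Type*) [Field k]
    (a21 a41 a32 a42 a13 a23 a14 a34 a1 a2 a3 a4 : ℕ)
    (h21 : 0 < a21)
    (h41 : 0 < a41)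
    (h32 : 0 < a32)
    (h42 : 0 < a42)
    (h13 : 0 < a13)
    (h23 : 0 < a23)
    (h14 : 0 < a14)
    (h34 : 0 < a34)
    (ha1 : a1 = a21 + a41)
    (ha2 : a2 = a32 + a42)
    (ha3 : a3 = a13 + a23)
    (ha4 : a4 = a14 + a34)
    (hc1 : a13 + a14 < a1)
    (hc2 : a4 < a41 + a42)
    (hc3 : a2 ≤ a21 + a23)
    (hc4 : a3 ≤ a32 + a34)
    (x1 x2 x3 x4 : MvPolynomial (Fin 4) k)
    (hx1 : x1 = X 0) (hx2 : x2 = X 1) (hx3 : x3 = X 2) (hx4 : x4 = X 3)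
    (I m : Ideal (MvPolynomial (Fin 4) k))
    (hI : I = Ideal.span {x3 ^ a13 * x4 ^ a14, x2 ^ a2, x3 ^ a3, x4 ^ a4, x2 ^ a42 * x3 ^ a13})
    (hm : m = Ideal.span {x1, x2, x3, x4})
    (g : Fin 5 → MvPolynomial (Fin 4) k)
    (hg : g = ![x3 ^ a13 * x4 ^ a14, x2 ^ a2, x3 ^ a3, x4 ^ a4, x2 ^ a42 * x3 ^ a13])
    (φ1 : (Fin 5 → MvPolynomial (Fin 4) k) →ₗ[MvPolynomial (Fin 4) k]
      MvPolynomial (Fin 4) k)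
    (hφ1 : ∀ v, φ1 v = ∑ i, v i * g i)
    (M2 : Matrix (Fin 5) (Fin 6) (MvPolynomial (Fin 4) k))
    (hM2 : M2 = !![-x4 ^ a34, 0, -x3 ^ a23, 0, x2 ^ a42, 0;
      0, -x4 ^ a4, 0, 0, 0, -x3 ^ a13;
      0, 0, x4 ^ a14, x2 ^ a42, 0, 0;
      x3 ^ a13, x2 ^ a2, 0, 0, 0, 0;
      0, 0, 0, -x3 ^ a23, -x4 ^ a14, x2 ^ a32])
    (M3 : Matrix (Fin 6) (Fin 2) (MvPolynomial (Fin 4) k))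
    (hM3 : M3 = !![x2 ^ a2, 0;
      -x3 ^ a13, 0;
      0, x2 ^ a42;
      0, -x4 ^ a14;
      x2 ^ a32 * x4 ^ a34, x3 ^ a23;
      x4 ^ a4, 0]) :
    Function.Injective ⇑M3.mulVecLin ∧
    Function.Exact ⇑M3.mulVecLin ⇑M2.mulVecLin ∧
    Function.Exact ⇑M2.mulVecLin ⇑φ1 ∧
    LinearMap.range φ1 = I ∧
    Function.Surjective (Ideal.Quotient.mk I) ∧
    (∀ i, g i ∈ m) ∧ (∀ i j, M2 i j ∈ m) ∧ (∀ i j, M3 i j ∈ m) := by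

  subst hx1 hx2 hx3 hx4 hI hm hg hM2 hM3 ha2 ha3 ha4
  have n12 : (1 : Fin 4) ≠ 2 := by decide
  have n13 : (1 : Fin 4) ≠ 3 := by decide
  have n23 : (2 : Fin 4) ≠ 3 := by decide
  have hX : ∀ (i : Fin 4) (n : ℕ), (X i ^ n : MvPolynomial (Fin 4) k) ≠ 0 :=
    fun i n => pow_ne_zero _ (X_ne_zero i)
  refine ⟨?_, ?_, ?_, ?_, Ideal.Quotient.mk_surjective, ?_⟩
  · rw [injective_iff_map_eq_zero]
    intro v hv
    have e1 := congrFun hv 1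
    have e2 := congrFun hv 2
    simp [mulVec, dotProduct, Fin.sum_univ_succ, h13.ne', h42.ne'] at e1 e2
    ext1 i
    fin_cases i <;> simp [e1, e2]
  · intro v
    constructor
    · intro hv
      have e0 := congrFun hv 0
      have e1 := congrFun hv 1
      have e2 := congrFun hv 2
      have e3 := congrFun hv 3
      simp [mulVec, dotProduct, Fin.sum_univ_succ] at e0 e1 e2 e3
      obtain ⟨p, hp0, hp1⟩ := exists_eq_mul_of_X_pow_mul_add_eq_zero n12.symm a13 (a32 + a42)
        (u := v 0) (v := v 1) (by linear_combination e3)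
      obtain ⟨q, hq2, hq3⟩ := exists_eq_mul_of_X_pow_mul_add_eq_zero n13.symm a14 a42
        (u := v 2) (v := v 3) (by linear_combination e2)
      have hv5 : v 5 = p * X 3 ^ (a14 + a34) := by
        apply mul_right_cancel₀ (hX 2 a13)
        rw [hp1] at e1
        linear_combination -e1
      have hv4 : v 4 = p * (X 1 ^ a32 * X 3 ^ a34) + q * X 2 ^ a23 := by
        apply mul_right_cancel₀ (hX 1 a42)
        rw [hp0, hq2] at e0
        linear_combination e0
      refine ⟨![p, q], ?_⟩
      ext1 i
      fin_cases i <;> simp [mulVec, dotProduct, Fin.sum_univ_succ, hp0, hp1, hq2, hq3, hv4, hv5] <;>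
        ring
    · rintro ⟨w, rfl⟩
      ext1 i
      fin_cases i <;> simp [mulVec, dotProduct, Fin.sum_univ_succ] <;> ring
  · intro u
    constructor
    · intro hu
      rw [hφ1] at hu
      simp [Fin.sum_univ_succ] at hu
      obtain ⟨α, β, γ, h1, h3, hs⟩ := exists_koszul_of_X_pow_mul_add_eq_zero n13 n12 n23.symm
        (a32 + a42) (a14 + a34) a13 (u := u 1) (v := u 3)
        (t := u 0 * X 3 ^ a14 + u 2 * X 2 ^ a23 + u 4 * X 1 ^ a42) (by linear_combination hu)
      obtain ⟨α', β', γ', h0, h2, h4⟩ := exists_koszul_of_X_pow_mul_add_eq_zero n23.symm n13.symm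
        n12.symm a14 a23 a42 (u := u 0 - β * X 3 ^ a34) (v := u 2)
        (t := u 4 - α * X 1 ^ a32) (by linear_combination hs)
      refine ⟨![-β, -γ, -γ', -β', -α', α], ?_⟩
      rw [sub_eq_iff_eq_add] at h0 h4
      ext1 i
      fin_cases i <;> simp [mulVec, dotProduct, Fin.sum_univ_succ, h0, h1, h2, h3, h4] <;> ring
    · rintro ⟨w, rfl⟩
      rw [hφ1]
      simp [mulVec, dotProduct, Fin.sum_univ_succ]
      ring
  · ext y
    have hset : ({X 2 ^ a13 * X 3 ^ a14, X 1 ^ (a32 + a42), X 2 ^ (a13 + a23), X 3 ^ (a14 + a34),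
        X 1 ^ a42 * X 2 ^ a13} : Set (MvPolynomial (Fin 4) k)) =
        Set.range ![X 2 ^ a13 * X 3 ^ a14, X 1 ^ (a32 + a42), X 2 ^ (a13 + a23),
          X 3 ^ (a14 + a34), X 1 ^ a42 * X 2 ^ a13] := by
      simp only [range_cons, range_empty, Set.union_empty, Set.singleton_union]
    rw [hset, Ideal.mem_span_range_iff_exists_fun, LinearMap.mem_range]
    simp only [hφ1]
  · have hm : ∀ (i : Fin 4) {n : ℕ}, 0 < n → (X i ^ n : MvPolynomial (Fin 4) k) ∈
        Ideal.span {X 0, X 1, X 2, X 3} := fun i n hn =>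
      Ideal.pow_mem_of_mem _ (Ideal.subset_span (by fin_cases i <;> simp)) _ hn
    have p2 := hm 1 (Nat.add_pos_left h32 a42)
    have p3 := hm 2 (Nat.add_pos_left h13 a23)
    have p4 := hm 3 (Nat.add_pos_left h14 a34)
    refine ⟨fun i => ?_, fun i j => ?_, fun i j => ?_⟩
    · fin_cases i <;> simp [Ideal.mul_mem_right, *]
    · fin_cases i <;> fin_cases j <;> simp [*]
    · fin_cases i <;> fin_cases j <;> simp [Ideal.mul_mem_right, *]
end

section
/- Let I be the ideal of R generated by x3^{a13}x4^{a14}, x2^{a2}, x3^{a3} − x2^{a32}x4^{a34}, x4^{a4}, x2^{a42}x3^{a13}. Then the sequence 0 → R →(φ3) R^5 →(φ2) R^5 →(φ1) R → R/I → 0 is exact, and it is a minimal free resolution of R/I. Here φ1 = (x3^{a13}x4^{a14}, x2^{a2}, x3^{a3}−x2^{a32}x4^{a34}, x4^{a4}, x2^{a42}x3^{a13}); φ2 is the 5×5 matrix with rows (−x3^{a23}, 0, x4^{a34}, x2^{a42}, 0), (0, x4^{a34}, 0, 0, x3^{a13}), (x4^{a14}, x2^{a42}, 0, 0, 0), (x2^{a32},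 0, −x3^{a13}, 0, 0), (0, −x3^{a23}, 0, −x4^{a14}, −x2^{a32}); and φ3 is the column vector (x2^{a42}x3^{a13}, −x3^{a13}x4^{a14}, x2^{a2}, x3^{a3}−x2^{a32}x4^{a34}, x4^{a4}). -/
open MvPolynomial Matrix

section MonomialIdeals

variable {σ k : Type*} [Field k]

theorem X_pow_dvd_of_dvd_X_pow_mul {i j : σ} (hij : i ≠ j) {n l : ℕ} {r : MvPolynomial σ k}
    (h : X i ^ n ∣ X j ^ l * r) : (X i ^ n : MvPolynomial σ k) ∣ r := by
  refine (X_prime (R := k) (i := i)).pow_dvd_of_dvd_mul_left n (fun hd => hij ?_) h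
  have hX : (X i : MvPolynomial σ k) ∣ X j := (X_prime (R := k) (i := i)).dvd_of_dvd_pow hd
  simpa using hX

theorem exists_of_X_pow_mul_eq {i j l : σ} (hij : i ≠ j) (hil : i ≠ l) {n p q : ℕ}
    {r u v : MvPolynomial σ k} (h : X i ^ n * r = X j ^ p * u + X l ^ q * v) :
    ∃ u' v' : MvPolynomial σ k, r = X j ^ p * u' + X l ^ q * v' := by
  classical
  have hspan : Ideal.span {(X j ^ p : MvPolynomial σ k), X l ^ q} =
      Ideal.span ((fun s => monomial s (1 : k)) ''
        {Finsupp.single j p, Finsupp.single l q}) := by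
    simp [Set.image_pair, X_pow_eq_monomial]
  have hmem : X i ^ n * r ∈ Ideal.span {(X j ^ p : MvPolynomial σ k), X l ^ q} :=
    Ideal.mem_span_pair.2 ⟨u, v, by rw [h]; ring⟩
  suffices hr : r ∈ Ideal.span {(X j ^ p : MvPolynomial σ k), X l ^ q} by
    obtain ⟨u', v', h'⟩ := Ideal.mem_span_pair.1 hr
    exact ⟨u', v', by rw [← h']; ring⟩
  rw [hspan, mem_ideal_span_monomial_image] at hmem ⊢
  intro d hd
  obtain ⟨s, hs, hle⟩ := hmem (Finsupp.single i n + d) (by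
    rw [mem_support_iff, X_pow_eq_monomial, coeff_monomial_mul, one_mul]
    exact mem_support_iff.1 hd)
  refine ⟨s, hs, ?_⟩
  rcases hs with rfl | rfl
  · rw [Finsupp.single_le_iff] at hle ⊢
    simpa [Finsupp.single_apply, hij] using hle
  · rw [Finsupp.single_le_iff] at hle ⊢
    simpa [Finsupp.single_apply, hil] using hle

/-- In three distinct variables, `X j ^ (c + d) - X i ^ a * X l ^ f` is a nonzerodivisor modulo
`(X i ^ b, X l ^ e)`. -/
theorem exists_of_X_pow_sub_mul_eq {i j l : σ} (hji : j ≠ i) (hjl : j ≠ l)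
    {a b c d e f : ℕ} (ha : 0 < a) {r u v : MvPolynomial σ k}
    (h : (X j ^ c * X j ^ d - X i ^ a * X l ^ f) * r = X i ^ b * u + X l ^ e * v) :
    ∃ u' v' : MvPolynomial σ k, r = X i ^ b * u' + X l ^ e * v' := by
  obtain ⟨w, hw⟩ := sub_dvd_pow_sub_pow (X j ^ c * X j ^ d : MvPolynomial σ k)
    (X i ^ a * X l ^ f) b
  obtain ⟨z, hz⟩ : (X i ^ b : MvPolynomial σ k) ∣ (X i ^ a * X l ^ f) ^ b := by
    rw [mul_pow, ← pow_mul]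
    exact dvd_mul_of_dvd_left (pow_dvd_pow _ (Nat.le_mul_of_pos_left b ha)) _
  refine exists_of_X_pow_mul_eq (n := (c + d) * b) hji hjl (u := u * w + z * r) (v := v * w) ?_
  rw [pow_mul, pow_add]
  linear_combination r * hw + w * h + r * hz

end MonomialIdeals

section Syzygies

variable {σ k : Type*} [Field k] {i j l : σ} {a b c d e f : ℕ}

theorem exists_first_syzygy (hij : i ≠ j) (hil : i ≠ l) (hjl : j ≠ l) (ha : 0 < a)
    {v₁ v₂ v₃ v₄ v₅ A B C D E F : MvPolynomial σ k}
    (hA : A = X i ^ a) (hB : B = X i ^ b) (hC : C = X j ^ c) (hD : D = X j ^ d)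
    (hE : E = X l ^ e) (hF : F = X l ^ f)
    (h : v₁ * (C * E) + v₂ * (A * B) + v₃ * (C * D - A * F) + v₄ * (E * F) + v₅ * (B * C) = 0) :
    ∃ s₁ s₂ s₃ s₄ s₅, v₁ = -D * s₁ + F * s₃ + B * s₄ ∧ v₂ = F * s₂ + C * s₅ ∧
      v₃ = E * s₁ + B * s₂ ∧ v₄ = A * s₁ - C * s₃ ∧ v₅ = -D * s₂ - E * s₄ - A * s₅ := by
  have hC0 : C ≠ 0 := hC ▸ pow_ne_zero _ (X_ne_zero j)
  have hB0 : B ≠ 0 := hB ▸ pow_ne_zero _ (X_ne_zero i)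
  obtain ⟨p, q, hv₂⟩ : ∃ p q, v₂ = F * p + C * q := by
    rw [hC, hF]
    refine exists_of_X_pow_mul_eq (n := a + b) hil hij
      (u := v₃ * A - v₄ * E) (v := -(v₁ * E + v₃ * D + v₅ * B)) ?_
    rw [pow_add, ← hA, ← hB, ← hC, ← hF]
    linear_combination h
  obtain ⟨r, hr⟩ : C ∣ v₄ * E - (v₃ - B * p) * A := by
    rw [hC]
    refine X_pow_dvd_of_dvd_X_pow_mul (l := f) hjl ?_
    rw [← hC, ← hF]
    refine ⟨-(v₁ * E + v₃ * D + v₅ * B + q * A * B), ?_⟩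
    rw [hv₂] at h
    linear_combination h
  obtain ⟨s, t, hv₃⟩ : ∃ s t, v₃ - B * p = E * s + C * t := by
    rw [hC, hE]
    refine exists_of_X_pow_mul_eq (n := a) hil hij (u := v₄) (v := -r) ?_
    rw [← hA, ← hC, ← hE]
    linear_combination -hr
  obtain ⟨u, hv₄⟩ : C ∣ v₄ - A * s := by
    rw [hC]
    refine X_pow_dvd_of_dvd_X_pow_mul (l := e) hjl ?_
    rw [← hC, ← hE]
    exact ⟨r + t * A, by linear_combination hr + A * hv₃⟩
  have hred : (v₁ + D * s + F * u) * E + t * (C * D - A * F) + (v₅ + D * p + A * q) * B = 0 := by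
    apply mul_left_cancel₀ hC0
    linear_combination h - A * B * hv₂ - (C * D - A * F) * hv₃ - E * F * hv₄
  obtain ⟨y, z, ht⟩ : ∃ y z, t = B * y + E * z := by
    rw [hB, hE]
    refine exists_of_X_pow_sub_mul_eq (c := c) (d := d) (f := f) hij.symm hjl ha
      (u := -(v₅ + D * p + A * q)) (v := -(v₁ + D * s + F * u)) ?_
    rw [← hA, ← hB, ← hC, ← hD, ← hE, ← hF]
    linear_combination hred
  have hfin : (v₁ + D * s + F * u + z * (C * D - A * F)) * E +
      (v₅ + D * p + A * q + y * (C * D - A * F)) * B = 0 := by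
    linear_combination hred - (C * D - A * F) * ht
  obtain ⟨w, hw⟩ : B ∣ v₁ + D * s + F * u + z * (C * D - A * F) := by
    rw [hB]
    refine X_pow_dvd_of_dvd_X_pow_mul (l := e) hil ?_
    rw [← hB, ← hE]
    exact ⟨-(v₅ + D * p + A * q + y * (C * D - A * F)), by linear_combination hfin⟩
  have hw' : v₅ + D * p + A * q + y * (C * D - A * F) = -(E * w) := by
    apply mul_left_cancel₀ hB0
    linear_combination hfin - E * hw
  refine ⟨s + C * z, p + C * y, -u + A * z, w, q - F * y, ?_, ?_, ?_, ?_, ?_⟩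
  · linear_combination hw
  · linear_combination hv₂
  · linear_combination hv₃ + C * ht
  · linear_combination hv₄
  · linear_combination hw'

theorem exists_second_syzygy (hil : i ≠ l) (hjl : j ≠ l)
    {w₁ w₂ w₃ w₄ w₅ A B C D E F : MvPolynomial σ k}
    (hB : B = X i ^ b) (hC : C = X j ^ c) (hE : E = X l ^ e) (hF : F = X l ^ f)
    (h₁ : -D * w₁ + F * w₃ + B * w₄ = 0) (h₂ : F * w₂ + C * w₅ = 0)
    (h₃ : E * w₁ + B * w₂ = 0) (h₄ : A * w₁ - C * w₃ = 0) :
    ∃ r, w₁ = B * C * r ∧ w₂ = -(C * E) * r ∧ w₃ = A * B * r ∧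
      w₄ = (C * D - A * F) * r ∧ w₅ = E * F * r := by
  have hC0 : C ≠ 0 := hC ▸ pow_ne_zero _ (X_ne_zero j)
  have hB0 : B ≠ 0 := hB ▸ pow_ne_zero _ (X_ne_zero i)
  have hE0 : E ≠ 0 := hE ▸ pow_ne_zero _ (X_ne_zero l)
  obtain ⟨s, hs⟩ : C ∣ w₂ := by
    rw [hC]
    refine X_pow_dvd_of_dvd_X_pow_mul (l := f) hjl ?_
    rw [← hC, ← hF]
    exact ⟨-w₅, by linear_combination h₂⟩
  obtain ⟨r, hr⟩ : E ∣ s := by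
    rw [hE]
    refine X_pow_dvd_of_dvd_X_pow_mul (l := c) hjl.symm ?_
    refine X_pow_dvd_of_dvd_X_pow_mul (l := b) hil.symm ?_
    rw [← hB, ← hC, ← hE]
    exact ⟨-w₁, by linear_combination h₃ - B * hs⟩
  have hw₁ : w₁ = B * C * -r := by
    apply mul_left_cancel₀ hE0
    linear_combination h₃ - B * hs - B * C * hr
  have hw₃ : w₃ = A * B * -r := by
    apply mul_left_cancel₀ hC0
    linear_combination A * hw₁ - h₄
  refine ⟨-r, hw₁, ?_, hw₃, ?_, ?_⟩
  · linear_combination hs + C * hr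
  · apply mul_left_cancel₀ hB0
    linear_combination h₁ + D * hw₁ - F * hw₃
  · apply mul_left_cancel₀ hC0
    linear_combination h₂ - F * hs - F * C * hr

end Syzygies

theorem gorenstein_tangent_cone_resolution_case_1b_stmt4
    (k : Type*) [Field k]
    (a21 a41 a32 a42 a13 a23 a14 a34 a1 a2 a3 a4 : ℕ)
    (h21 : 0 < a21)
    (h41 : 0 < a41)
    (h32 : 0 < a32)
    (h42 : 0 < a42)
    (h13 : 0 < a13)
    (h23 : 0 < a23)
    (h14 : 0 < a14)
    (h34 : 0 < a34)
    (ha1 : a1 = a21 + a41)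
    (ha2 : a2 = a32 + a42)
    (ha3 : a3 = a13 + a23)
    (ha4 : a4 = a14 + a34)
    (hc1 : a13 + a14 < a1)
    (hc2 : a4 < a41 + a42)
    (hc3 : a2 ≤ a21 + a23)
    (hc4 : a3 ≤ a32 + a34)
    (x1 x2 x3 x4 : MvPolynomial (Fin 4) k)
    (hx1 : x1 = X 0) (hx2 : x2 = X 1) (hx3 : x3 = X 2) (hx4 : x4 = X 3)
    (I m : Ideal (MvPolynomial (Fin 4) k))
    (hI : I = Ideal.span {x3 ^ a13 * x4 ^ a14, x2 ^ a2, x3 ^ a3 - x2 ^ a32 * x4 ^ a34, x4 ^ a4, x2 ^ a42 * x3 ^ a13})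
    (hm : m = Ideal.span {x1, x2, x3, x4})
    (g : Fin 5 → MvPolynomial (Fin 4) k)
    (hg : g = ![x3 ^ a13 * x4 ^ a14, x2 ^ a2, x3 ^ a3 - x2 ^ a32 * x4 ^ a34, x4 ^ a4, x2 ^ a42 * x3 ^ a13])
    (φ1 : (Fin 5 → MvPolynomial (Fin 4) k) →ₗ[MvPolynomial (Fin 4) k]
      MvPolynomial (Fin 4) k)
    (hφ1 : ∀ v, φ1 v = ∑ i, v i * g i)
    (M2 : Matrix (Fin 5) (Fin 5) (MvPolynomial (Fin 4) k))
    (hM2 : M2 = !![-x3 ^ a23, 0, x4 ^ a34, x2 ^ a42, 0;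
      0, x4 ^ a34, 0, 0, x3 ^ a13;
      x4 ^ a14, x2 ^ a42, 0, 0, 0;
      x2 ^ a32, 0, -x3 ^ a13, 0, 0;
      0, -x3 ^ a23, 0, -x4 ^ a14, -x2 ^ a32])
    (M3 : Matrix (Fin 5) (Fin 1) (MvPolynomial (Fin 4) k))
    (hM3 : M3 = !![x2 ^ a42 * x3 ^ a13;
      -(x3 ^ a13 * x4 ^ a14);
      x2 ^ a2;
      x3 ^ a3 - x2 ^ a32 * x4 ^ a34;
      x4 ^ a4]) :
    Function.Injective ⇑M3.mulVecLin ∧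
    Function.Exact ⇑M3.mulVecLin ⇑M2.mulVecLin ∧
    Function.Exact ⇑M2.mulVecLin ⇑φ1 ∧
    LinearMap.range φ1 = I ∧
    Function.Surjective (Ideal.Quotient.mk I) ∧
    (∀ i, g i ∈ m) ∧ (∀ i j, M2 i j ∈ m) ∧ (∀ i j, M3 i j ∈ m) := by
  subst hI hm hg hM2 hM3 ha2 ha3 ha4
  have e2 : x2 ∈ Ideal.span {x1, x2, x3, x4} := Ideal.subset_span (by simp)
  have e3 : x3 ∈ Ideal.span {x1, x2, x3, x4} := Ideal.subset_span (by simp)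
  have e4 : x4 ∈ Ideal.span {x1, x2, x3, x4} := Ideal.subset_span (by simp)
  generalize Ideal.span {x1, x2, x3, x4} = m at e2 e3 e4 ⊢
  have p2 : ∀ n, 0 < n → x2 ^ n ∈ m := fun n hn => Ideal.pow_mem_of_mem _ e2 n hn
  have p3 : ∀ n, 0 < n → x3 ^ n ∈ m := fun n hn => Ideal.pow_mem_of_mem _ e3 n hn
  have p4 : ∀ n, 0 < n → x4 ^ n ∈ m := fun n hn => Ideal.pow_mem_of_mem _ e4 n hn
  have q1 : x3 ^ a13 * x4 ^ a14 ∈ m := m.mul_mem_right _ (p3 _ h13)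
  have q2 : x2 ^ (a32 + a42) ∈ m := p2 _ (by omega)
  have q3 : x3 ^ (a13 + a23) - x2 ^ a32 * x4 ^ a34 ∈ m :=
    m.sub_mem (p3 _ (by omega)) (m.mul_mem_right _ (p2 _ h32))
  have q4 : x4 ^ (a14 + a34) ∈ m := p4 _ (by omega)
  have q5 : x2 ^ a42 * x3 ^ a13 ∈ m := m.mul_mem_right _ (p2 _ h42)
  have hij : (1 : Fin 4) ≠ 2 := by decide
  have hil : (1 : Fin 4) ≠ 3 := by decide
  have hjl : (2 : Fin 4) ≠ 3 := by decide
  refine ⟨?_, ?_, ?_, ?_, Ideal.Quotient.mk_surjective, ?_, ?_, ?_⟩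
  · rw [← LinearMap.ker_eq_bot, LinearMap.ker_eq_bot']
    intro v hv
    have hv2 := congrFun hv 2
    simp [Matrix.mulVec, dotProduct, hx2] at hv2
    funext t
    fin_cases t
    simpa using hv2
  · intro w
    constructor
    · intro hw
      have w1 := congrFun hw 0
      have w2 := congrFun hw 1
      have w3 := congrFun hw 2
      have w4 := congrFun hw 3
      simp [Matrix.mulVec, dotProduct, Fin.sum_univ_five] at w1 w2 w3 w4
      obtain ⟨r, r1, r2, r3, r4, r5⟩ := exists_second_syzygy (A := x2 ^ a32) (D := x3 ^ a23)
        (w₁ := w 0) (w₂ := w 1) (w₃ := w 2) (w₄ := w 3) (w₅ := w 4) hil hjl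
        (congrArg (· ^ a42) hx2) (congrArg (· ^ a13) hx3) (congrArg (· ^ a14) hx4)
        (congrArg (· ^ a34) hx4) (by linear_combination w1) w2 w3 (by linear_combination w4)
      refine ⟨![r], ?_⟩
      funext t
      fin_cases t <;> simp [Matrix.mulVec, dotProduct, r1, r2, r3, r4, r5, pow_add,
        -mul_eq_mul_left_iff, -mul_eq_mul_right_iff]
    · rintro ⟨r, rfl⟩
      funext t
      fin_cases t <;> simp [Matrix.mulVec, dotProduct, Fin.sum_univ_five] <;> ring
  · intro v
    constructor
    · intro hv
      rw [hφ1] at hv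
      simp [Fin.sum_univ_five] at hv
      obtain ⟨s1, s2, s3, s4, s5, r1, r2, r3, r4, r5⟩ := exists_first_syzygy
        (v₁ := v 0) (v₂ := v 1) (v₃ := v 2) (v₄ := v 3) (v₅ := v 4) hij hil hjl h32
        (congrArg (· ^ a32) hx2) (congrArg (· ^ a42) hx2) (congrArg (· ^ a13) hx3)
        (congrArg (· ^ a23) hx3) (congrArg (· ^ a14) hx4)
        (congrArg (· ^ a34) hx4) (by linear_combination hv)
      refine ⟨![s1, s2, s3, s4, s5], ?_⟩
      funext t
      fin_cases t <;>
        simp [Matrix.mulVec, dotProduct, Fin.sum_univ_five, r1, r2, r3, r4, r5] <;> ring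
    · rintro ⟨s, rfl⟩
      rw [hφ1]
      simp [Matrix.mulVec, dotProduct, Fin.sum_univ_five]
      ring
  · apply le_antisymm
    · rintro _ ⟨v, rfl⟩
      rw [hφ1]
      refine Ideal.sum_mem _ fun t _ => Ideal.mul_mem_left _ _ (Ideal.subset_span ?_)
      fin_cases t <;> simp
    · refine Ideal.span_le.2 ?_
      have hmem : ∀ t, ![x3 ^ a13 * x4 ^ a14, x2 ^ (a32 + a42),
          x3 ^ (a13 + a23) - x2 ^ a32 * x4 ^ a34, x4 ^ (a14 + a34), x2 ^ a42 * x3 ^ a13] t ∈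
          LinearMap.range φ1 := fun t => ⟨Pi.single t 1, by simp [hφ1, Pi.single_apply]⟩
      rintro y (rfl | rfl | rfl | rfl | rfl)
      exacts [hmem 0, hmem 1, hmem 2, hmem 3, hmem 4]
  · intro t
    fin_cases t <;> simpa
  · intro s t
    fin_cases s <;> fin_cases t <;> simp [h13, h23, h14, h34, h32, h42, p2, p3, p4]
  · intro s t
    fin_cases s <;> fin_cases t <;> simpa
end

section
/- Let I be the ideal of R generated by x3^{a13}x4^{a14}, x2^{a2} − x1^{a21}x3^{a23}, x3^{a3} − x2^{a32}x4^{a34}, x4^{a4}, x2^{a42}x3^{a13} − x1^{a21}x4^{a34}. Then the sequence 0 → R →(φ3) R^5 →(φ2) R^5 →(φ1) R → R/I → 0 is exact, and it is a minimal free resolution of R/I. Here φ1 = (x3^{a13}x4^{a14}, x2^{a2}−x1^{a21}x3^{a23}, x3^{a3}−x2^{a32}x4^{a34}, x4^{a4}, x2^{a42}x3^{a13}−x1^{a21}x4^{a34}); φ2 is the 5×5 matrix with rows (−x4^{a34}, x3^{a23}, −x2^{a42}, 0, 0), (0, 0, 0, x4^{a34}, −x3^{a13}), (0, −x4^{a14},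 0, x2^{a42}, −x1^{a21}), (x3^{a13}, −x2^{a32}, x1^{a21}, 0, 0), (0, 0, x4^{a14}, −x3^{a23}, x2^{a32}); and φ3 is the column vector (x2^{a2}−x1^{a21}x3^{a23}, x2^{a42}x3^{a13}−x1^{a21}x4^{a34}, x3^{a3}−x2^{a32}x4^{a34}, x3^{a13}x4^{a14}, x4^{a4}). -/
open MvPolynomial Matrix

section Domain

variable {R : Type*} [CommRing R] [IsDomain R]

/-- The syzygies of the maximal minors of the matrix with rows `(a, b, c)` and `(d, e, f)` are
generated by its rows, as soon as two of the minors are relatively prime. -/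
lemma exists_eq_of_syzygy_minors {a b c d e f : R} (hne : d * c - a * f ≠ 0)
    (hcop : ∀ p, d * c - a * f ∣ (b * d - a * e) * p → d * c - a * f ∣ p)
    {u v w : R}
    (h : u * (b * d - a * e) + v * (c * e - b * f) + w * (d * c - a * f) = 0) :
    ∃ s r, u = f * s - c * r ∧ v = d * s - a * r ∧ w = b * r - e * s := by
  obtain ⟨s, hs⟩ := hcop (c * v - a * u) ⟨b * v + a * w, by linear_combination -a * h⟩
  obtain ⟨r, hr⟩ := hcop (f * v - d * u) ⟨e * v + d * w, by linear_combination -d * h⟩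
  have hu : u = f * s - c * r :=
    mul_left_cancel₀ hne (by linear_combination f * hs - c * hr)
  have hv : v = d * s - a * r :=
    mul_left_cancel₀ hne (by linear_combination d * hs - a * hr)
  refine ⟨s, r, hu, hv, mul_left_cancel₀ hne ?_⟩
  subst hu hv
  linear_combination h

/-- The syzygies of `c * t`, `t * f` and the maximal minors of the matrix with rows `(a, b, c)` and
`(d, e, f)` under regularity assumptions. -/
lemma exists_eq_of_syzygy {a b c d e f t : R} (hne : d * c - a * f ≠ 0)
    (hcop : ∀ p, d * c - a * f ∣ (b * d - a * e) * p → d * c - a * f ∣ p)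
    (hreg : ∀ p u v w,
      u * (b * d - a * e) + v * (c * e - b * f) + w * (d * c - a * f) = t * p →
      ∃ u' v' w', p = u' * (b * d - a * e) + v' * (c * e - b * f) + w' * (d * c - a * f))
    (hcf : ∀ u v, u * c + v * f = 0 → ∃ r, u = -f * r ∧ v = c * r)
    (hmin : ∀ p u v, u * c + v * f + p * (b * d - a * e) = 0 → ∃ α β, p = α * c + β * f)
    {v₀ v₁ v₂ v₃ v₄ : R}
    (h : v₀ * (c * t) + v₁ * (b * d - a * e) + v₂ * (c * e - b * f) + v₃ * (t * f)
      + v₄ * (d * c - a * f) = 0) :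
    ∃ s₀ s₁ s₂ s₃ s₄, v₀ = -f * s₀ + e * s₁ - d * s₂ ∧ v₁ = f * s₃ - c * s₄ ∧
      v₂ = -t * s₁ + d * s₃ - a * s₄ ∧ v₃ = c * s₀ - b * s₁ + a * s₂ ∧
      v₄ = t * s₂ - e * s₃ + b * s₄ := by
  obtain ⟨p₁, p₂, p₄, hp⟩ := hreg (-(v₀ * c + v₃ * f)) v₁ v₂ v₄ (by linear_combination h)
  obtain ⟨s, r, h₁, h₂, h₄⟩ := exists_eq_of_syzygy_minors (u := v₁ - t * p₁) (v := v₂ - t * p₂)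
    (w := v₄ - t * p₄) hne hcop (by linear_combination h + t * hp)
  obtain ⟨α, β, rfl⟩ := hmin p₁ (v₀ + p₂ * e + p₄ * d) (v₃ - p₂ * b - p₄ * a)
    (by linear_combination -hp)
  obtain ⟨r₀, h₀, h₃⟩ := hcf
    (v₀ + (p₂ - α * a - β * d) * e + (p₄ + α * b + β * e) * d)
    (v₃ - (p₂ - α * a - β * d) * b - (p₄ + α * b + β * e) * a)
    (by linear_combination -hp)
  refine ⟨r₀, -(p₂ - α * a - β * d), p₄ + α * b + β * e, s + t * β, r - t * α, ?_, ?_, ?_, ?_, ?_⟩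
  · linear_combination h₀
  · linear_combination h₁
  · linear_combination h₂
  · linear_combination h₃
  · linear_combination h₄

/-- The second syzygies attached to the maximal minors of the matrix with rows `(a, b, c)` and
`(d, e, f)`, together with `c * t` and `t * f`. -/
lemma exists_eq_mul_of_second_syzygy {a b c d e f t : R} (hc : c ≠ 0) (ht : t ≠ 0)
    (hcf : ∀ u v, u * c + v * f = 0 → ∃ r, u = -f * r ∧ v = c * r)
    (hdvd : ∀ p, t ∣ (d * c - a * f) * p → t ∣ p)
    {v₀ v₁ v₂ v₃ v₄ : R} (h₀ : -f * v₀ + e * v₁ - d * v₂ = 0) (h₁ : f * v₃ - c * v₄ = 0)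
    (h₂ : -t * v₁ + d * v₃ - a * v₄ = 0) (h₃ : c * v₀ - b * v₁ + a * v₂ = 0)
    (h₄ : t * v₂ - e * v₃ + b * v₄ = 0) :
    ∃ r, v₀ = (b * d - a * e) * r ∧ v₁ = (d * c - a * f) * r ∧ v₂ = (c * e - b * f) * r ∧
      v₃ = c * t * r ∧ v₄ = t * f * r := by
  obtain ⟨q, hq₄, hq₃⟩ := hcf (-v₄) v₃ (by linear_combination h₁)
  have hq₄' : v₄ = f * q := by linear_combination -hq₄
  subst hq₃ hq₄'
  obtain ⟨r, rfl⟩ := hdvd q ⟨v₁, by linear_combination h₂⟩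
  have e₁ : v₁ = (d * c - a * f) * r := mul_left_cancel₀ ht (by linear_combination -h₂)
  have e₂ : v₂ = (c * e - b * f) * r := mul_left_cancel₀ ht (by linear_combination h₄)
  refine ⟨r, mul_left_cancel₀ hc ?_, e₁, e₂, by ring, by ring⟩
  subst e₁ e₂
  linear_combination h₃

end Domain

section Polynomial

variable {σ k : Type*} [Field k]

open Classical in
/-- The substitution `X i ↦ 0`. -/
noncomputable def killVar (i : σ) : MvPolynomial σ k →ₐ[k] MvPolynomial σ k :=
  aeval fun j => if j = i then 0 else X j

@[simp]
lemma killVar_X_self (i : σ) : killVar (k := k) i (X i) = 0 := by simp [killVar]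

lemma killVar_X_of_ne {i j : σ} (h : j ≠ i) : killVar (k := k) i (X j) = X j := by
  simp [killVar, h]

lemma exists_eq_killVar_add (i : σ) (p : MvPolynomial σ k) :
    ∃ q, p = killVar i p + X i * q := by
  induction p using MvPolynomial.induction_on with
  | C c => exact ⟨0, by simp [killVar]⟩
  | add p q hp hq =>
    obtain ⟨p', hp⟩ := hp
    obtain ⟨q', hq⟩ := hq
    exact ⟨p' + q', by rw [map_add]; linear_combination hp + hq⟩
  | mul_X p j hp =>
    obtain ⟨p', hp⟩ := hp
    by_cases hj : j = i
    · subst hj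
      exact ⟨p, by rw [map_mul, killVar_X_self]; ring⟩
    · exact ⟨p' * X j, by rw [map_mul, killVar_X_of_ne hj]; linear_combination X j * hp⟩

lemma killVar_eq_self_of_dvd {i : σ} {p q : MvPolynomial σ k} (hq : q ≠ 0)
    (hqi : degreeOf i q = 0) (h : p ∣ q) : killVar i p = p := by
  obtain ⟨r, rfl⟩ := h
  rw [degreeOf_mul_eq (left_ne_zero_of_mul hq) (right_ne_zero_of_mul hq)] at hqi
  have hp : i ∉ p.vars := by
    rw [mem_vars_iff_degreeOf_ne_zero]
    omega
  refine hom_congr_vars (f₁ := (killVar i : MvPolynomial σ k →ₐ[k] _).toRingHom)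
    (f₂ := RingHom.id _) ?_ ?_ rfl
  · ext c : 1
    exact (killVar i).commutes c
  · intro j hj _
    exact killVar_X_of_ne fun hji => hp (hji ▸ hj)

/-- `X j ^ n` is a nonzerodivisor modulo `(X i ^ a, X l ^ b)`. -/
lemma exists_eq_of_X_pow_mul {i j l : σ} (hi : i ≠ j) (hl : l ≠ j) (a b n : ℕ)
    {p u v : MvPolynomial σ k} (h : X j ^ n * p = u * X i ^ a + v * X l ^ b) :
    ∃ α β, p = α * X i ^ a + β * X l ^ b := by
  induction n generalizing u v with
  | zero => exact ⟨u, v, by simpa using h⟩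
  | succ n ih =>
    obtain ⟨u', hu⟩ := exists_eq_killVar_add j u
    obtain ⟨v', hv⟩ := exists_eq_killVar_add j v
    have h0 := congrArg (killVar j) h
    simp only [map_mul, map_add, map_pow, killVar_X_self, killVar_X_of_ne hi,
      killVar_X_of_ne hl] at h0
    refine ih (u := u') (v := v') (mul_left_cancel₀ (X_ne_zero j) ?_)
    linear_combination h + X i ^ a * hu + X l ^ b * hv - h0

lemma not_X_dvd_X_pow {i j : σ} (h : i ≠ j) (n : ℕ) : ¬ (X i : MvPolynomial σ k) ∣ X j ^ n :=
  fun hd => h (by simpa using (X_prime (R := k) (i := i)).dvd_of_dvd_pow hd)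

end Polynomial

section FourVariables

variable {k : Type*} [Field k]

lemma not_X_two_dvd (a b e : ℕ) (he : 0 < e) :
    ¬ (X 2 : MvPolynomial (Fin 4) k) ∣ X 1 ^ b - X 0 ^ a * X 2 ^ e := fun h =>
  not_X_dvd_X_pow (i := (2 : Fin 4)) (j := 1) (by decide) b
    ((dvd_sub_left ((dvd_pow_self _ he.ne').mul_left _)).mp h)

lemma not_X_one_dvd (a b e : ℕ) (hb : 0 < b) :
    ¬ (X 1 : MvPolynomial (Fin 4) k) ∣ X 1 ^ b - X 0 ^ a * X 2 ^ e := fun h =>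
  ((X_prime.dvd_or_dvd ((dvd_sub_right (dvd_pow_self _ hb.ne')).mp h)).elim
    (not_X_dvd_X_pow (by decide) a) (not_X_dvd_X_pow (by decide) e))

lemma not_X_three_dvd (a b c f : ℕ) (hf : 0 < f) :
    ¬ (X 3 : MvPolynomial (Fin 4) k) ∣ X 1 ^ b * X 2 ^ c - X 0 ^ a * X 3 ^ f := fun h =>
  (X_prime.dvd_or_dvd ((dvd_sub_left ((dvd_pow_self _ hf.ne').mul_left _)).mp h)).elim
    (not_X_dvd_X_pow (by decide) b) (not_X_dvd_X_pow (by decide) c)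

lemma isRelPrime_minors (a b c e f d : ℕ) (hb : 0 < b) (he : 0 < e) (hf : 0 < f) :
    IsRelPrime (X 1 ^ d * X 2 ^ c - X 0 ^ a * X 3 ^ f : MvPolynomial (Fin 4) k)
      (X 1 ^ b - X 0 ^ a * X 2 ^ e) := by
  have hne : (X 1 ^ b - X 0 ^ a * X 2 ^ e : MvPolynomial (Fin 4) k) ≠ 0 := fun h0 =>
    not_X_two_dvd (k := k) a b e he (h0 ▸ dvd_zero _)
  refine ((UniqueFactorizationMonoid.isRelPrime_iff_no_prime_factors hne).mpr ?_).symm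
  intro q h₁ h₂ hq
  have hdeg : degreeOf 3 (X 1 ^ b - X 0 ^ a * X 2 ^ e : MvPolynomial (Fin 4) k) = 0 := by
    have h := degreeOf_sub_le 3 (X 1 ^ b : MvPolynomial (Fin 4) k) (X 0 ^ a * X 2 ^ e)
    simpa only [degreeOf_mul_X_pow_of_ne e (show (3 : Fin 4) ≠ 2 by decide),
      degreeOf_X_pow_of_ne b (show (3 : Fin 4) ≠ 1 by decide),
      degreeOf_X_pow_of_ne a (show (3 : Fin 4) ≠ 0 by decide), max_self, nonpos_iff_eq_zero] using h
  have h₃ := map_dvd (killVar (3 : Fin 4)) h₂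
  rw [killVar_eq_self_of_dvd hne hdeg h₁] at h₃
  simp only [map_sub, map_mul, map_pow, killVar_X_self, ne_eq, Fin.reduceEq, not_false_eq_true,
    killVar_X_of_ne, zero_pow hf.ne', mul_zero, sub_zero] at h₃
  have key : ∀ i : Fin 4, q ∣ X i → (X i : MvPolynomial (Fin 4) k) ∣
      X 1 ^ b - X 0 ^ a * X 2 ^ e := fun i hi =>
    ((X_prime.irreducible.dvd_iff.mp hi).resolve_left hq.not_isUnit).dvd.trans h₁
  rcases hq.dvd_or_dvd h₃ with h | h
  · exact not_X_one_dvd a b e hb (key 1 (hq.dvd_of_dvd_pow h))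
  · exact not_X_two_dvd a b e he (key 2 (hq.dvd_of_dvd_pow h))

lemma exists_eq_of_X_pow_syzygy {i j : Fin 4} (hij : i ≠ j) (c f : ℕ)
    {u v : MvPolynomial (Fin 4) k} (h : u * X i ^ c + v * X j ^ f = 0) :
    ∃ r, u = -X j ^ f * r ∧ v = X i ^ c * r := by
  obtain ⟨r, rfl⟩ : X i ^ c ∣ v := by
    refine X_prime.pow_dvd_of_dvd_mul_left c (not_X_dvd_X_pow hij f) ⟨-u, ?_⟩
    linear_combination h
  refine ⟨r, mul_left_cancel₀ (pow_ne_zero c (X_ne_zero i)) ?_, rfl⟩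
  linear_combination h

lemma exists_eq_of_mul_minor (a b c e f : ℕ) (he : 0 < e) {p u v : MvPolynomial (Fin 4) k}
    (h : u * X 2 ^ c + v * X 3 ^ f + p * (X 1 ^ b - X 0 ^ a * X 2 ^ e) = 0) :
    ∃ α β, p = α * X 2 ^ c + β * X 3 ^ f := by
  obtain ⟨q, hq⟩ := sub_dvd_pow_sub_pow (X 1 ^ b : MvPolynomial (Fin 4) k) (X 0 ^ a * X 2 ^ e) c
  obtain ⟨s, hs⟩ : (X 2 ^ c : MvPolynomial (Fin 4) k) ∣ (X 0 ^ a * X 2 ^ e) ^ c :=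
    pow_dvd_pow_of_dvd ((dvd_pow_self _ he.ne').mul_left _) c
  refine exists_eq_of_X_pow_mul (j := 1) (n := b * c) (u := s * p - q * u) (v := -q * v)
    (by decide) (by decide) c f ?_
  rw [pow_mul]
  linear_combination p * hq + p * hs + q * h

lemma exists_eq_of_minors_eq_X_mul (a b c d e f : ℕ) (he : 0 < e) (hf : 0 < f)
    {p u v w : MvPolynomial (Fin 4) k}
    (h : u * (X 1 ^ b * X 1 ^ d - X 0 ^ a * X 2 ^ e) + v * (X 2 ^ c * X 2 ^ e - X 1 ^ b * X 3 ^ f)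
      + w * (X 1 ^ d * X 2 ^ c - X 0 ^ a * X 3 ^ f) = X 3 * p) :
    ∃ u' v' w', p = u' * (X 1 ^ b * X 1 ^ d - X 0 ^ a * X 2 ^ e)
      + v' * (X 2 ^ c * X 2 ^ e - X 1 ^ b * X 3 ^ f)
      + w' * (X 1 ^ d * X 2 ^ c - X 0 ^ a * X 3 ^ f) := by
  have h0 := congrArg (killVar (3 : Fin 4)) h
  simp only [map_add, map_sub, map_mul, map_pow, killVar_X_self, ne_eq, Fin.reduceEq,
    not_false_eq_true, killVar_X_of_ne, zero_pow hf.ne', mul_zero, zero_mul, sub_zero] at h0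
  obtain ⟨u₁, hu⟩ := exists_eq_killVar_add 3 u
  obtain ⟨v₁, hv⟩ := exists_eq_killVar_add 3 v
  obtain ⟨w₁, hw⟩ := exists_eq_killVar_add 3 w
  generalize killVar 3 u = u₀ at *
  generalize killVar 3 v = v₀ at *
  generalize killVar 3 w = w₀ at *
  obtain ⟨s, rfl⟩ : X 2 ^ c ∣ u₀ := by
    refine X_prime.pow_dvd_of_dvd_mul_left c (not_X_two_dvd a (b + d) e he)
      ⟨-(v₀ * X 2 ^ e + w₀ * X 1 ^ d), ?_⟩
    linear_combination h0
  obtain ⟨r, h₁, h₂⟩ := exists_eq_of_X_pow_syzygy (i := 1) (j := 2) (by decide) d e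
    (u := s * X 1 ^ b + w₀) (v := v₀ - s * X 0 ^ a)
    (mul_left_cancel₀ (pow_ne_zero c (X_ne_zero 2)) (by linear_combination h0))
  obtain ⟨n, rfl⟩ := Nat.exists_eq_add_of_lt hf
  refine ⟨u₁ - X 3 ^ n * r, v₁, w₁, mul_left_cancel₀ (X_ne_zero 3) ?_⟩
  linear_combination -h + (X 1 ^ b * X 1 ^ d - X 0 ^ a * X 2 ^ e) * hu
    + (X 2 ^ c * X 2 ^ e - X 1 ^ b * X 3 ^ (0 + n + 1)) * (hv + h₂)
    + (X 1 ^ d * X 2 ^ c - X 0 ^ a * X 3 ^ (0 + n + 1)) * (hw + h₁)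

lemma exists_eq_of_minors_eq_X_pow_mul (a b c d e f n : ℕ) (he : 0 < e) (hf : 0 < f)
    {p u v w : MvPolynomial (Fin 4) k}
    (h : u * (X 1 ^ b * X 1 ^ d - X 0 ^ a * X 2 ^ e) + v * (X 2 ^ c * X 2 ^ e - X 1 ^ b * X 3 ^ f)
      + w * (X 1 ^ d * X 2 ^ c - X 0 ^ a * X 3 ^ f) = X 3 ^ n * p) :
    ∃ u' v' w', p = u' * (X 1 ^ b * X 1 ^ d - X 0 ^ a * X 2 ^ e)
      + v' * (X 2 ^ c * X 2 ^ e - X 1 ^ b * X 3 ^ f)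
      + w' * (X 1 ^ d * X 2 ^ c - X 0 ^ a * X 3 ^ f) := by
  induction n generalizing u v w with
  | zero => exact ⟨u, v, w, by linear_combination -h⟩
  | succ n ih =>
    obtain ⟨u', v', w', h'⟩ := exists_eq_of_minors_eq_X_mul a b c d e f he hf
      (p := X 3 ^ n * p) (h.trans (by ring))
    exact ih h'.symm

end FourVariables

theorem gorenstein_tangent_cone_resolution_case_1b_stmt5
    (k : Type*) [Field k]
    (a21 a41 a32 a42 a13 a23 a14 a34 a1 a2 a3 a4 : ℕ)
    (h21 : 0 < a21)
    (h41 : 0 < a41)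
    (h32 : 0 < a32)
    (h42 : 0 < a42)
    (h13 : 0 < a13)
    (h23 : 0 < a23)
    (h14 : 0 < a14)
    (h34 : 0 < a34)
    (ha1 : a1 = a21 + a41)
    (ha2 : a2 = a32 + a42)
    (ha3 : a3 = a13 + a23)
    (ha4 : a4 = a14 + a34)
    (hc1 : a13 + a14 < a1)
    (hc2 : a4 < a41 + a42)
    (hc3 : a2 ≤ a21 + a23)
    (hc4 : a3 ≤ a32 + a34)
    (x1 x2 x3 x4 : MvPolynomial (Fin 4) k)
    (hx1 : x1 = X 0) (hx2 : x2 = X 1) (hx3 : x3 = X 2) (hx4 : x4 = X 3)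
    (I m : Ideal (MvPolynomial (Fin 4) k))
    (hI : I = Ideal.span {x3 ^ a13 * x4 ^ a14, x2 ^ a2 - x1 ^ a21 * x3 ^ a23, x3 ^ a3 - x2 ^ a32 * x4 ^ a34, x4 ^ a4, x2 ^ a42 * x3 ^ a13 - x1 ^ a21 * x4 ^ a34})
    (hm : m = Ideal.span {x1, x2, x3, x4})
    (g : Fin 5 → MvPolynomial (Fin 4) k)
    (hg : g = ![x3 ^ a13 * x4 ^ a14, x2 ^ a2 - x1 ^ a21 * x3 ^ a23, x3 ^ a3 - x2 ^ a32 * x4 ^ a34, x4 ^ a4, x2 ^ a42 * x3 ^ a13 - x1 ^ a21 * x4 ^ a34])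
    (φ1 : (Fin 5 → MvPolynomial (Fin 4) k) →ₗ[MvPolynomial (Fin 4) k]
      MvPolynomial (Fin 4) k)
    (hφ1 : ∀ v, φ1 v = ∑ i, v i * g i)
    (M2 : Matrix (Fin 5) (Fin 5) (MvPolynomial (Fin 4) k))
    (hM2 : M2 = !![-x4 ^ a34, x3 ^ a23, -x2 ^ a42, 0, 0;
      0, 0, 0, x4 ^ a34, -x3 ^ a13;
      0, -x4 ^ a14, 0, x2 ^ a42, -x1 ^ a21;
      x3 ^ a13, -x2 ^ a32, x1 ^ a21, 0, 0;
      0, 0, x4 ^ a14, -x3 ^ a23, x2 ^ a32])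
    (M3 : Matrix (Fin 5) (Fin 1) (MvPolynomial (Fin 4) k))
    (hM3 : M3 = !![x2 ^ a2 - x1 ^ a21 * x3 ^ a23;
      x2 ^ a42 * x3 ^ a13 - x1 ^ a21 * x4 ^ a34;
      x3 ^ a3 - x2 ^ a32 * x4 ^ a34;
      x3 ^ a13 * x4 ^ a14;
      x4 ^ a4]) :
    Function.Injective ⇑M3.mulVecLin ∧
    Function.Exact ⇑M3.mulVecLin ⇑M2.mulVecLin ∧
    Function.Exact ⇑M2.mulVecLin ⇑φ1 ∧
    LinearMap.range φ1 = I ∧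
    Function.Surjective (Ideal.Quotient.mk I) ∧
    (∀ i, g i ∈ m) ∧ (∀ i j, M2 i j ∈ m) ∧ (∀ i j, M3 i j ∈ m) := by
  have hcf : ∀ u v : MvPolynomial (Fin 4) k, u * X 2 ^ a13 + v * X 3 ^ a34 = 0 →
      ∃ r, u = -X 3 ^ a34 * r ∧ v = X 2 ^ a13 * r := fun u v =>
    exists_eq_of_X_pow_syzygy (by decide) a13 a34
  subst hx1 hx2 hx3 hx4 ha2 ha3 ha4 hM2 hM3 hm
  have hX : ∀ (i : Fin 4) {n : ℕ}, 0 < n →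
      X i ^ n ∈ (Ideal.span {X 0, X 1, X 2, X 3} : Ideal (MvPolynomial (Fin 4) k)) :=
    fun i n hn => Ideal.pow_mem_of_mem _
      (Ideal.subset_span (by fin_cases i <;> simp)) n hn
  have hrange : I = Ideal.span (Set.range g) := by
    rw [hI, hg]
    congr 1
    ext p
    simp only [Set.mem_insert_iff, Set.mem_singleton_iff, Matrix.range_cons, Matrix.range_empty,
      Set.union_empty, Set.mem_union]
  subst hI
  refine ⟨?_, ?_, ?_, ?_, Ideal.Quotient.mk_surjective, ?_, ?_, ?_⟩
  · rw [← LinearMap.ker_eq_bot, LinearMap.ker_eq_bot']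
    intro v hv
    have h4 := congrFun hv 4
    simp [Matrix.mulVec, dotProduct, X_ne_zero] at h4
    ext i : 1
    rw [Subsingleton.elim i 0, h4, Pi.zero_apply]
  · intro v
    constructor
    · intro h
      have h' := fun i => congrFun h i
      simp [Fin.forall_fin_succ, Matrix.mulVec, dotProduct, Fin.sum_univ_succ] at h'
      obtain ⟨h₀, h₁, h₂, h₃, h₄⟩ := h'
      obtain ⟨r, e₀, e₁, e₂, e₃, e₄⟩ := exists_eq_mul_of_second_syzygy
        (a := X 0 ^ a21) (b := X 1 ^ a32) (c := X 2 ^ a13) (d := X 1 ^ a42) (e := X 2 ^ a23)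
        (f := X 3 ^ a34) (t := X 3 ^ a14) (pow_ne_zero _ (X_ne_zero _))
        (pow_ne_zero _ (X_ne_zero _)) hcf
        (fun _ => X_prime.pow_dvd_of_dvd_mul_left _ (not_X_three_dvd a21 a42 a13 a34 h34))
        (v₀ := v 0) (v₁ := v 1) (v₂ := v 2) (v₃ := v 3) (v₄ := v 4)
        (by linear_combination h₀) (by linear_combination h₁) (by linear_combination h₂)
        (by linear_combination h₃) (by linear_combination h₄)
      refine ⟨fun _ => r, ?_⟩
      ext i : 1
      fin_cases i <;>
        simp [Matrix.mulVec, dotProduct, e₀, e₁, e₂, e₃, e₄, pow_add]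
    · rintro ⟨r, rfl⟩
      ext i : 1
      fin_cases i <;>
        simp [Matrix.mulVec, dotProduct, Fin.sum_univ_succ] <;> ring
  · intro v
    rw [hφ1, hg]
    constructor
    · intro h
      simp [Fin.sum_univ_succ] at h
      obtain ⟨s₀, s₁, s₂, s₃, s₄, e₀, e₁, e₂, e₃, e₄⟩ := exists_eq_of_syzygy
        (a := X 0 ^ a21) (b := X 1 ^ a32) (c := X 2 ^ a13) (d := X 1 ^ a42) (e := X 2 ^ a23)
        (f := X 3 ^ a34) (t := X 3 ^ a14)
        (fun h0 => not_X_three_dvd (k := k) a21 a42 a13 a34 h34 (h0 ▸ dvd_zero _))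
        (fun _ => by
          rw [← pow_add]
          exact (isRelPrime_minors a21 (a32 + a42) a13 a23 a34 a42 (by omega) h23
            h34).dvd_of_dvd_mul_left)
        (fun _ _ _ _ => exists_eq_of_minors_eq_X_pow_mul a21 a32 a13 a42 a23 a34 a14 h23 h34)
        hcf
        (fun _ _ _ => by
          rw [← pow_add]
          exact exists_eq_of_mul_minor a21 (a32 + a42) a13 a23 a34 h23)
        (v₀ := v 0) (v₁ := v 1) (v₂ := v 2) (v₃ := v 3) (v₄ := v 4)
        (by linear_combination h)
      refine ⟨![s₀, s₁, s₂, s₃, s₄], ?_⟩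
      ext i : 1
      fin_cases i <;>
        simp [Matrix.mulVec, dotProduct, Fin.sum_univ_succ, e₀, e₁, e₂, e₃, e₄] <;> ring
    · rintro ⟨s, rfl⟩
      simp [Matrix.mulVec, dotProduct, Fin.sum_univ_succ]
      ring
  · ext p
    rw [hrange, Ideal.span, Submodule.mem_span_range_iff_exists_fun]
    simp [hφ1]
  · subst hg
    simp only [Fin.forall_fin_succ, IsEmpty.forall_iff, and_true]
    exact ⟨Ideal.mul_mem_left _ _ (hX 3 h14),
      Ideal.sub_mem _ (hX 1 (by omega)) (Ideal.mul_mem_left _ _ (hX 2 h23)),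
      Ideal.sub_mem _ (hX 2 (by omega)) (Ideal.mul_mem_left _ _ (hX 3 h34)), hX 3 (by omega),
      Ideal.sub_mem _ (Ideal.mul_mem_left _ _ (hX 2 h13)) (Ideal.mul_mem_left _ _ (hX 3 h34))⟩
  · intro i j
    fin_cases i <;> fin_cases j <;>
      first
      | exact zero_mem _
      | exact hX _ ‹_›
      | exact neg_mem (hX _ ‹_›)
  · simp only [Fin.forall_fin_succ, IsEmpty.forall_iff, and_true]
    exact ⟨Ideal.sub_mem _ (hX 1 (by omega)) (Ideal.mul_mem_left _ _ (hX 2 h23)),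
      Ideal.sub_mem _ (Ideal.mul_mem_left _ _ (hX 2 h13)) (Ideal.mul_mem_left _ _ (hX 3 h34)),
      Ideal.sub_mem _ (hX 2 (by omega)) (Ideal.mul_mem_left _ _ (hX 3 h34)),
      Ideal.mul_mem_left _ _ (hX 3 h14),
      hX 3 (by omega)⟩
end

section
/- Let I be the ideal of R generated by x2^{a12}x3^{a13}, x2^{a2}, x3^{a3}, x4^{a4}, x3^{a13}x4^{a24}. Then the sequence 0 → R^2 →(φ3) R^6 →(φ2) R^5 →(φ1) R → R/I → 0 is exact, and it is a minimal free resolution of R/I. Here φ1 = (x2^{a12}x3^{a13}, x2^{a2}, x3^{a3}, x4^{a4}, x3^{a13}x4^{a24}); φ2 is the 5×6 matrix with rows (x4^{a24}, x3^{a43}, x2^{a32}, 0, 0, 0), (0, 0, −x3^{a13}, 0, 0, −x4^{a4}), (0, −x2^{a12}, 0, 0, −x4^{a24}, 0), (0, 0, 0, −x3^{a13}, 0, x2^{a2}), (−x2^{a12}, 0, 0, x4^{a34}, x3^{a43}, 0); and φ3 is the 6×2 matrix with rows (x3^{a43}, x2^{a32}x4^{a34}), (−x4^{a24}, 0), (0,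 −x4^{a4}), (0, x2^{a2}), (x2^{a12}, 0), (0, x3^{a13}). -/
open MvPolynomial Matrix

/-- A monomial whose support is disjoint from those of the generators of a monomial ideal is a
nonzerodivisor modulo that ideal. -/
lemma MvPolynomial.mem_span_monomial_of_mul_monomial_mem {σ k : Type*} [Field k]
    {S : Set (σ →₀ ℕ)} {e : σ →₀ ℕ} (hS : ∀ s ∈ S, Disjoint s.support e.support)
    {f : MvPolynomial σ k}
    (hf : f * monomial e 1 ∈ Ideal.span ((fun s => monomial s (1 : k)) '' S)) :
    f ∈ Ideal.span ((fun s => monomial s (1 : k)) '' S) := by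
  rw [mem_ideal_span_monomial_image] at hf ⊢
  intro d hd
  obtain ⟨s, hs, hle⟩ := hf (d + e) (by
    rw [mem_support_iff, coeff_mul_monomial, mul_one]
    exact mem_support_iff.mp hd)
  refine ⟨s, hs, fun i => ?_⟩
  by_cases hi : s i = 0
  · simp [hi]
  · have he : e i = 0 := by
      simpa using Finset.disjoint_left.mp (hS s hs) (Finsupp.mem_support_iff.mpr hi)
    simpa [he] using hle i

lemma MvPolynomial.exists_eq_of_mul_X_pow_eq {σ k : Type*} [Field k] {i j l : σ}
    (hi : i ≠ l) (hj : j ≠ l) {a b c : ℕ} {f u v : MvPolynomial σ k}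
    (h : f * X l ^ c = u * X i ^ a + v * X j ^ b) :
    ∃ u' v', f = u' * X i ^ a + v' * X j ^ b := by
  have hspan : Ideal.span ((fun s => monomial s (1 : k)) ''
      {Finsupp.single i a, Finsupp.single j b}) = Ideal.span {X i ^ a, X j ^ b} := by
    simp [Set.image_insert_eq, X_pow_eq_monomial]
  have key := mem_span_monomial_of_mul_monomial_mem (f := f) (e := Finsupp.single l c)
    (S := {Finsupp.single i a, Finsupp.single j b}) (by
      rintro s (rfl | rfl)
      · exact Finset.disjoint_of_subset_left Finsupp.support_single_subset
          (Finset.disjoint_of_subset_right Finsupp.support_single_subset (by simpa using hi))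
      · exact Finset.disjoint_of_subset_left Finsupp.support_single_subset
          (Finset.disjoint_of_subset_right Finsupp.support_single_subset (by simpa using hj)))
  rw [hspan, ← X_pow_eq_monomial, h, Ideal.mem_span_pair, Ideal.mem_span_pair] at key
  obtain ⟨u', v', h'⟩ := key ⟨u, v, rfl⟩
  exact ⟨u', v', h'.symm⟩

lemma MvPolynomial.exists_koszul_X_pow_pair {σ k : Type*} [Field k] {i j : σ}
    (hij : i ≠ j) {a b : ℕ} {f g : MvPolynomial σ k} (h : f * X i ^ a + g * X j ^ b = 0) :
    ∃ u, f = u * X j ^ b ∧ g = -u * X i ^ a := by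
  obtain ⟨u, v, hg⟩ := exists_eq_of_mul_X_pow_eq (f := g) (u := -f) (v := 0) (c := b) (a := a)
    (b := a) hij hij (by linear_combination h)
  refine ⟨-(u + v), mul_right_cancel₀ (pow_ne_zero a (X_ne_zero i)) ?_, ?_⟩
  · rw [hg] at h
    linear_combination h
  · linear_combination hg

lemma MvPolynomial.exists_koszul_X_pow_triple {σ k : Type*} [Field k] {i j l : σ}
    (hij : i ≠ j) (hil : i ≠ l) (hjl : j ≠ l) {a b c : ℕ} {f g h : MvPolynomial σ k}
    (H : f * X i ^ a + g * X j ^ b + h * X l ^ c = 0) :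
    ∃ u v w, f = u * X j ^ b + v * X l ^ c ∧ g = -u * X i ^ a + w * X l ^ c ∧
      h = -v * X i ^ a - w * X j ^ b := by
  obtain ⟨v, w, hh⟩ := exists_eq_of_mul_X_pow_eq (f := h) (u := -f) (v := -g) (c := c) (a := a)
    (b := b) hil hjl (by linear_combination H)
  obtain ⟨u, hf, hg⟩ := exists_koszul_X_pow_pair (f := f + v * X l ^ c) (g := g + w * X l ^ c)
    (a := a) (b := b) hij (by rw [hh] at H; linear_combination H)
  exact ⟨u, -v, -w, by linear_combination hf, by linear_combination hg,
    by linear_combination hh⟩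

theorem gorenstein_tangent_cone_resolution_case_2b_stmt6
    (k : Type*) [Field k]
    (a21 a41 a12 a32 a13 a43 a24 a34 a1 a2 a3 a4 : ℕ)
    (h21 : 0 < a21)
    (h41 : 0 < a41)
    (h12 : 0 < a12)
    (h32 : 0 < a32)
    (h13 : 0 < a13)
    (h43 : 0 < a43)
    (h24 : 0 < a24)
    (h34 : 0 < a34)
    (ha1 : a1 = a21 + a41)
    (ha2 : a2 = a12 + a32)
    (ha3 : a3 = a13 + a43)
    (ha4 : a4 = a24 + a34)
    (hc1 : a12 + a13 < a1)
    (hc2 : a4 < a41 + a43)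
    (hc3 : a2 ≤ a21 + a24)
    (hc4 : a3 ≤ a32 + a34)
    (x1 x2 x3 x4 : MvPolynomial (Fin 4) k)
    (hx1 : x1 = X 0) (hx2 : x2 = X 1) (hx3 : x3 = X 2) (hx4 : x4 = X 3)
    (I m : Ideal (MvPolynomial (Fin 4) k))
    (hI : I = Ideal.span {x2 ^ a12 * x3 ^ a13, x2 ^ a2, x3 ^ a3, x4 ^ a4, x3 ^ a13 * x4 ^ a24})
    (hm : m = Ideal.span {x1, x2, x3, x4})
    (g : Fin 5 → MvPolynomial (Fin 4) k)
    (hg : g = ![x2 ^ a12 * x3 ^ a13, x2 ^ a2, x3 ^ a3, x4 ^ a4, x3 ^ a13 * x4 ^ a24])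
    (φ1 : (Fin 5 → MvPolynomial (Fin 4) k) →ₗ[MvPolynomial (Fin 4) k]
      MvPolynomial (Fin 4) k)
    (hφ1 : ∀ v, φ1 v = ∑ i, v i * g i)
    (M2 : Matrix (Fin 5) (Fin 6) (MvPolynomial (Fin 4) k))
    (hM2 : M2 = !![x4 ^ a24, x3 ^ a43, x2 ^ a32, 0, 0, 0;
      0, 0, -x3 ^ a13, 0, 0, -x4 ^ a4;
      0, -x2 ^ a12, 0, 0, -x4 ^ a24, 0;
      0, 0, 0, -x3 ^ a13, 0, x2 ^ a2;
      -x2 ^ a12, 0, 0, x4 ^ a34, x3 ^ a43, 0])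
    (M3 : Matrix (Fin 6) (Fin 2) (MvPolynomial (Fin 4) k))
    (hM3 : M3 = !![x3 ^ a43, x2 ^ a32 * x4 ^ a34;
      -x4 ^ a24, 0;
      0, -x4 ^ a4;
      0, x2 ^ a2;
      x2 ^ a12, 0;
      0, x3 ^ a13]) :
    Function.Injective ⇑M3.mulVecLin ∧
    Function.Exact ⇑M3.mulVecLin ⇑M2.mulVecLin ∧
    Function.Exact ⇑M2.mulVecLin ⇑φ1 ∧
    LinearMap.range φ1 = I ∧
    Function.Surjective (Ideal.Quotient.mk I) ∧
    (∀ i, g i ∈ m) ∧ (∀ i j, M2 i j ∈ m) ∧ (∀ i j, M3 i j ∈ m) := by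
  subst hx1 hx2 hx3 hx4 ha2 ha3 ha4
  have h23 : (1 : Fin 4) ≠ 2 := by decide
  have h24' : (1 : Fin 4) ≠ 3 := by decide
  have h34' : (2 : Fin 4) ≠ 3 := by decide
  have hX : ∀ (i : Fin 4) (n : ℕ), (X i : MvPolynomial (Fin 4) k) ^ n ≠ 0 :=
    fun i n => pow_ne_zero n (X_ne_zero i)
  have hmX : ∀ i ∈ ({1, 2, 3} : Set (Fin 4)), ∀ n, 0 < n →
      (X i : MvPolynomial (Fin 4) k) ^ n ∈ m := by
    rintro i (rfl | rfl | rfl) n hn <;>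
      exact Ideal.pow_mem_of_mem _ (hm ▸ Ideal.subset_span (by simp)) n hn
  have hm2 := hmX 1 (by simp)
  have hm3 := hmX 2 (by simp)
  have hm4 := hmX 3 (by simp)
  have h22 := hm2 _ (Nat.add_pos_left h12 a32)
  have h44 := hm4 _ (Nat.add_pos_left h24 a34)
  have hM2v : ∀ w, M2.mulVecLin w =
      ![w 0 * X 3 ^ a24 + w 1 * X 2 ^ a43 + w 2 * X 1 ^ a32,
        -(w 2 * X 2 ^ a13 + w 5 * X 3 ^ (a24 + a34)),
        -(w 1 * X 1 ^ a12 + w 4 * X 3 ^ a24),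
        -(w 3 * X 2 ^ a13) + w 5 * X 1 ^ (a12 + a32),
        -(w 0 * X 1 ^ a12) + w 3 * X 3 ^ a34 + w 4 * X 2 ^ a43] := by
    intro w
    rw [hM2]
    ext1 i
    fin_cases i <;> simp [Matrix.mulVec, dotProduct, Fin.sum_univ_succ] <;> ring
  have hM3v : ∀ y, M3.mulVecLin y =
      ![y 0 * X 2 ^ a43 + y 1 * (X 1 ^ a32 * X 3 ^ a34), -(y 0 * X 3 ^ a24),
        -(y 1 * X 3 ^ (a24 + a34)), y 1 * X 1 ^ (a12 + a32), y 0 * X 1 ^ a12,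
        y 1 * X 2 ^ a13] := by
    intro y
    rw [hM3]
    ext1 i
    fin_cases i <;> simp [Matrix.mulVec, dotProduct, Fin.sum_univ_succ] <;> ring
  have hφ : ∀ v, φ1 v = v 0 * (X 1 ^ a12 * X 2 ^ a13) + v 1 * X 1 ^ (a12 + a32) +
      v 2 * X 2 ^ (a13 + a43) + v 3 * X 3 ^ (a24 + a34) + v 4 * (X 2 ^ a13 * X 3 ^ a24) := by
    intro v
    rw [hφ1, hg]
    simp [Fin.sum_univ_succ]
    ring
  refine ⟨?_, ?_, ?_, ?_, Ideal.Quotient.mk_surjective, ?_, ?_, ?_⟩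
  · rw [injective_iff_map_eq_zero]
    intro y hy
    rw [hM3v] at hy
    have e4 := congrFun hy 4
    have e5 := congrFun hy 5
    simp [hX] at e4 e5
    ext1 i
    fin_cases i <;> simp [e4, e5]
  · intro w
    constructor
    · intro hw
      rw [hM2v] at hw
      have e0 := congrFun hw 0
      have e1 := congrFun hw 1
      have e2 := congrFun hw 2
      have e3 := congrFun hw 3
      simp at e0 e1 e2 e3
      obtain ⟨z, hz2, hz5⟩ := exists_koszul_X_pow_pair (f := w 2) (g := w 5)
        (a := a13) (b := a24 + a34) h34' (by linear_combination -e1)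
      obtain ⟨y, hy1, hy4⟩ := exists_koszul_X_pow_pair (f := w 1) (g := w 4)
        (a := a12) (b := a24) h24' (by linear_combination -e2)
      have hw3 : w 3 = -z * X 1 ^ (a12 + a32) := by
        apply mul_right_cancel₀ (hX 2 a13)
        rw [hz5] at e3
        linear_combination -e3
      have hw0 : w 0 = -y * X 2 ^ a43 + -z * (X 1 ^ a32 * X 3 ^ a34) := by
        apply mul_right_cancel₀ (hX 3 a24)
        rw [hy1, hz2] at e0
        linear_combination e0
      refine ⟨![-y, -z], ?_⟩
      rw [hM3v]
      ext1 i
      fin_cases i <;> simp [hw0, hy1, hz2, hw3, hy4, hz5]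
    · rintro ⟨y, rfl⟩
      rw [hM2v, hM3v]
      ext1 i
      fin_cases i <;> simp <;> ring
  · intro v
    constructor
    · intro hv
      rw [hφ] at hv
      obtain ⟨u, t, w, -, h1, h3⟩ := exists_koszul_X_pow_triple
        (f := v 0 * X 1 ^ a12 + v 2 * X 2 ^ a43 + v 4 * X 3 ^ a24) (g := v 1) (h := v 3)
        (a := a13) (b := a12 + a32) (c := a24 + a34) h23.symm h34' h24'
        (by linear_combination hv)
      obtain ⟨p, q, r, h0, h2, h4⟩ := exists_koszul_X_pow_triple
        (f := v 0 - u * X 1 ^ a32) (g := v 2) (h := v 4 - t * X 3 ^ a34)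
        (a := a12) (b := a43) (c := a24) h23 h24' h34' (by
          apply mul_right_cancel₀ (hX 2 a13)
          rw [h1, h3] at hv
          linear_combination hv)
      refine ⟨![q, p, u, t, -r, -w], ?_⟩
      rw [hM2v]
      ext1 i
      fin_cases i <;> simp
      · linear_combination -h0
      · linear_combination -h1
      · linear_combination -h2
      · linear_combination -h3
      · linear_combination -h4
    · rintro ⟨w, rfl⟩
      rw [hφ, hM2v]
      simp
      ring
  · have hr : Set.range g = {X 1 ^ a12 * X 2 ^ a13, X 1 ^ (a12 + a32), X 2 ^ (a13 + a43),
        X 3 ^ (a24 + a34), X 2 ^ a13 * X 3 ^ a24} := by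
      rw [hg]
      simp only [Matrix.range_cons, Matrix.range_empty, Set.union_empty, Set.singleton_union]
    rw [hI, ← hr]
    ext f
    rw [LinearMap.mem_range, Ideal.mem_span_range_iff_exists_fun]
    simp [hφ1]
  · intro i
    rw [hg]
    fin_cases i
    · exact Ideal.mul_mem_right _ _ (hm2 _ h12)
    · exact h22
    · exact hm3 _ (by omega)
    · exact h44
    · exact Ideal.mul_mem_right _ _ (hm3 _ h13)
  · intro i j
    rw [hM2]
    fin_cases i <;> fin_cases j <;>
      simp [hm2, hm3, hm4, h12, h32, h13, h43, h24, h34]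
  · intro i j
    rw [hM3]
    fin_cases i <;> fin_cases j <;>
      simp [hm2, hm3, hm4, h12, h32, h13, h43, h24, Ideal.mul_mem_right]
end

section
/- Let I be the ideal of R generated by x2^{a12}x3^{a13}, x2^{a2}, x3^{a3} − x2^{a32}x4^{a34}, x4^{a4}, x3^{a13}x4^{a24}. Then the sequence 0 → R →(φ3) R^5 →(φ2) R^5 →(φ1) R → R/I → 0 is exact, and it is a minimal free resolution of R/I. Here φ1 = (x2^{a12}x3^{a13}, x2^{a2}, x3^{a3}−x2^{a32}x4^{a34}, x4^{a4}, x3^{a13}x4^{a24}); φ2 is the 5×5 matrix with rows (−x4^{a24}, 0, 0, −x2^{a32}, −x3^{a43}), (0, 0, 0, x3^{a13}, x4^{a34}), (0, −x4^{a24}, 0, 0, x2^{a12}), (0, −x2^{a32}, −x3^{a13}, 0, 0), (x2^{a12}, x3^{a43}, x4^{a34}, 0, 0); and φ3 is the column vector (x3^{a3}−x2^{a32}x4^{a34}, −x2^{a12}x3^{a13}, x2^{a2}, x4^{a4}, −x3^{a13}x4^{a24}). -/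
open MvPolynomial Matrix

section MonomialRegularity

variable {σ R : Type*} [CommRing R]

theorem MvPolynomial.mem_span_X_pow_pair_of_mul_X_pow_mem {i j l : σ} (hij : i ≠ j) (hil : i ≠ l)
    {n m q : ℕ} {x : MvPolynomial σ R}
    (h : x * X i ^ n ∈ Ideal.span {(X j ^ m : MvPolynomial σ R), X l ^ q}) :
    x ∈ Ideal.span {(X j ^ m : MvPolynomial σ R), X l ^ q} := by
  have key : ({(X j ^ m : MvPolynomial σ R), X l ^ q} : Set (MvPolynomial σ R)) =
      (fun s => monomial s (1 : R)) '' {Finsupp.single j m, Finsupp.single l q} := by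
    simp [Set.image_pair, X_pow_eq_monomial]
  rw [key, mem_ideal_span_monomial_image] at h ⊢
  intro d hd
  have hd' : d + Finsupp.single i n ∈ (x * X i ^ n).support := by
    rw [X_pow_eq_monomial, mem_support_iff, coeff_mul_monomial, mul_one]
    exact mem_support_iff.mp hd
  obtain ⟨s, hs, hle⟩ := h _ hd'
  refine ⟨s, hs, ?_⟩
  rcases hs with rfl | rfl
  · have := hle j
    rw [Finsupp.single_le_iff]
    simpa [Finsupp.single_eq_of_ne hij, Finsupp.single_eq_of_ne hij.symm] using this
  · have := hle l
    rw [Finsupp.single_le_iff]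
    simpa [Finsupp.single_eq_of_ne hil, Finsupp.single_eq_of_ne hil.symm] using this

theorem MvPolynomial.exists_eq_of_mul_X_pow_eq_s8 {i j l : σ} (hij : i ≠ j) (hil : i ≠ l)
    {n m q : ℕ} {x y z : MvPolynomial σ R}
    (h : x * X i ^ n = y * X j ^ m + z * X l ^ q) :
    ∃ y' z', x = y' * X j ^ m + z' * X l ^ q := by
  have := mem_span_X_pow_pair_of_mul_X_pow_mem (n := n) (m := m) (q := q) (x := x) hij hil
    (Ideal.mem_span_pair.mpr ⟨y, z, h.symm⟩)
  obtain ⟨y', z', h'⟩ := Ideal.mem_span_pair.mp this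
  exact ⟨y', z', h'.symm⟩

theorem MvPolynomial.exists_eq_mul_X_pow_of_mul_X_pow_eq {i j : σ} (hij : i ≠ j)
    {n m : ℕ} {x y : MvPolynomial σ R} (h : x * X i ^ n = y * X j ^ m) :
    ∃ e, x = e * X j ^ m ∧ y = e * X i ^ n := by
  obtain ⟨e, e', he⟩ := exists_eq_of_mul_X_pow_eq_s8 (n := n) (m := m) (q := m) (x := x) (y := y)
    (z := 0) hij hij (by rw [h]; ring)
  have hx : x = (e + e') * X j ^ m := by rw [he]; ring
  refine ⟨e + e', hx, ?_⟩
  rw [hx] at h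
  apply (isRegular_X_pow (R := R) (n := j) m).right
  change y * X j ^ m = (e + e') * X i ^ n * X j ^ m
  rw [← h]; ring

end MonomialRegularity

section Syzygies

variable {σ k : Type*} [Field k] {i j l : σ} {p q r s t u : ℕ}

/-- The second syzygies are generated by a single column. -/
theorem MvPolynomial.second_syzygy_eq (hij : i ≠ j) (hil : i ≠ l)
    {w₁ w₂ w₃ w₄ w₅ : MvPolynomial σ k}
    (h₁ : -X l ^ t * w₁ + -X i ^ q * w₄ + -X j ^ s * w₅ = 0)
    (h₂ : X j ^ r * w₄ + X l ^ u * w₅ = 0)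
    (h₃ : -X l ^ t * w₂ + X i ^ p * w₅ = 0)
    (h₄ : -X i ^ q * w₂ + -X j ^ r * w₃ = 0) :
    ∃ f, w₁ = (X j ^ (r + s) - X i ^ q * X l ^ u) * f ∧ w₂ = -(X i ^ p * X j ^ r) * f ∧
      w₃ = X i ^ (p + q) * f ∧ w₄ = X l ^ (t + u) * f ∧ w₅ = -(X j ^ r * X l ^ t) * f := by
  obtain ⟨e, he₅, he₂⟩ := exists_eq_mul_X_pow_of_mul_X_pow_eq (x := w₅) (y := w₂)
    (n := p) (m := t) hil (by linear_combination h₃)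
  obtain ⟨f, hf, hf₃⟩ := exists_eq_mul_X_pow_of_mul_X_pow_eq (x := -e) (y := w₃)
    (n := p + q) (m := r) hij (by rw [he₂] at h₄; rw [pow_add]; linear_combination h₄)
  have hX : ∀ (a : σ) (n : ℕ), (X a ^ n : MvPolynomial σ k) ≠ 0 :=
    fun a n => pow_ne_zero _ (X_ne_zero a)
  have h2 : w₂ = -(X i ^ p * X j ^ r) * f := by linear_combination he₂ - X i ^ p * hf
  have h5 : w₅ = -(X j ^ r * X l ^ t) * f := by linear_combination he₅ - X l ^ t * hf
  have h4 : w₄ = X l ^ (t + u) * f := by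
    apply mul_left_cancel₀ (hX j r)
    rw [h5] at h₂
    rw [pow_add]
    linear_combination h₂
  refine ⟨f, ?_, h2, by rw [hf₃]; ring, h4, h5⟩
  apply mul_left_cancel₀ (hX l t)
  rw [h4, h5, pow_add] at h₁
  rw [pow_add]
  linear_combination -h₁

/-- The first syzygies are generated by the five columns of the second differential. -/
theorem MvPolynomial.first_syzygy_eq (hij : i ≠ j) (hil : i ≠ l) (hjl : j ≠ l) (hq : 0 < q)
    {v₁ v₂ v₃ v₄ v₅ : MvPolynomial σ k}
    (h : v₁ * (X i ^ p * X j ^ r) + v₂ * X i ^ (p + q) +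
      v₃ * (X j ^ (r + s) - X i ^ q * X l ^ u) + v₄ * X l ^ (t + u) +
      v₅ * (X j ^ r * X l ^ t) = 0) :
    ∃ w₁ w₂ w₃ w₄ w₅, v₁ = -X l ^ t * w₁ + -X i ^ q * w₄ + -X j ^ s * w₅ ∧
      v₂ = X j ^ r * w₄ + X l ^ u * w₅ ∧
      v₃ = -X l ^ t * w₂ + X i ^ p * w₅ ∧
      v₄ = -X i ^ q * w₂ + -X j ^ r * w₃ ∧
      v₅ = X i ^ p * w₁ + X j ^ s * w₂ + X l ^ u * w₃ := by
  obtain ⟨α, γ, hv₃⟩ : ∃ α γ, v₃ = α * X i ^ p + γ * X l ^ t := by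
    obtain ⟨S, hS⟩ := sub_dvd_pow_sub_pow (X j ^ (r + s) : MvPolynomial σ k)
      (X i ^ q * X l ^ u) p
    obtain ⟨T, hT⟩ : (X i ^ p : MvPolynomial σ k) ∣ (X i ^ q) ^ p := by
      rw [← pow_mul]
      exact pow_dvd_pow _ (Nat.le_mul_of_pos_left p hq)
    rw [mul_pow, hT, ← pow_mul] at hS
    refine exists_eq_of_mul_X_pow_eq_s8 (n := (r + s) * p) hij.symm hjl
      (y := v₃ * T * (X l ^ u) ^ p - S * (v₁ * X j ^ r + v₂ * X i ^ q))
      (z := - S * (v₄ * X l ^ u + v₅ * X j ^ r)) ?_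
    rw [pow_add (X i), pow_add (X l)] at h
    linear_combination v₃ * hS + S * h
  have hv : ∀ {v₁ v₂ v₄ v₅ : MvPolynomial σ k}, X i ^ p * (v₁ * X j ^ r + v₂ * X i ^ q) +
      X l ^ t * (v₄ * X l ^ u + v₅ * X j ^ r) = 0 →
      ∃ β δ ε ζ, v₁ = X l ^ t * β + X i ^ q * ε ∧
        v₂ = X l ^ t * X l ^ u * δ - X j ^ r * ε ∧
        v₄ = -X i ^ p * X i ^ q * δ - X j ^ r * ζ ∧ v₅ = -X i ^ p * β + X l ^ u * ζ := by
    intro v₁ v₂ v₄ v₅ h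
    obtain ⟨w, hw₁, hw₂⟩ := exists_eq_mul_X_pow_of_mul_X_pow_eq
      (x := v₁ * X j ^ r + v₂ * X i ^ q) (y := -(v₄ * X l ^ u + v₅ * X j ^ r))
      (n := p) (m := t) hil (by linear_combination h)
    obtain ⟨y₁, z₁, hw₃⟩ := exists_eq_of_mul_X_pow_eq_s8 (x := w) (n := t) (m := r) (q := q)
      hjl.symm hil.symm hw₁.symm
    obtain ⟨y₂, z₂, hw₄⟩ := exists_eq_of_mul_X_pow_eq_s8 (x := w) (n := p) (m := u) (q := r)
      (y := -v₄) (z := -v₅) hil hij (by linear_combination -hw₂)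
    obtain ⟨δ, β', hz₁⟩ := exists_eq_of_mul_X_pow_eq_s8 (x := z₁) (n := q) (m := u) (q := r)
      (y := y₂) (z := z₂ - y₁) hil hij (by linear_combination hw₄ - hw₃)
    obtain ⟨β, hβ⟩ : ∃ β, β = y₁ + β' * X i ^ q := ⟨_, rfl⟩
    have hw : w = β * X j ^ r + δ * (X i ^ q * X l ^ u) := by
      rw [hw₃, hz₁, hβ]; ring
    rw [hw] at hw₁ hw₂
    obtain ⟨ε, hε₁, hε₂⟩ := exists_eq_mul_X_pow_of_mul_X_pow_eq
      (x := v₁ - X l ^ t * β) (y := X l ^ t * X l ^ u * δ - v₂)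
      (n := r) (m := q) hij.symm (by linear_combination hw₁)
    obtain ⟨ζ, hζ₁, hζ₂⟩ := exists_eq_mul_X_pow_of_mul_X_pow_eq
      (x := v₅ + X i ^ p * β) (y := -(v₄ + X i ^ p * X i ^ q * δ))
      (n := r) (m := u) hjl (by linear_combination -hw₂)
    exact ⟨β, δ, ε, ζ, by linear_combination hε₁, by linear_combination -hε₂,
      by linear_combination -hζ₂, by linear_combination hζ₁⟩
  obtain ⟨β, δ, ε, ζ, e₁, e₂, e₄, e₅⟩ := hv (v₁ := v₁ + X j ^ s * α) (v₂ := v₂ - X l ^ u * α)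
    (v₄ := v₄ - X i ^ q * γ) (v₅ := v₅ + X j ^ s * γ) (by
      rw [hv₃, pow_add, pow_add, pow_add] at h
      linear_combination h)
  refine ⟨-β - X j ^ s * δ, X i ^ p * δ - γ, ζ, -ε, α + X l ^ t * δ, ?_, ?_, ?_, ?_, ?_⟩
  · linear_combination e₁
  · linear_combination e₂
  · linear_combination hv₃
  · linear_combination e₄
  · linear_combination e₅

end Syzygies

theorem gorenstein_tangent_cone_resolution_case_2b_stmt8
    (k : Type*) [Field k]
    (a21 a41 a12 a32 a13 a43 a24 a34 a1 a2 a3 a4 : ℕ)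
    (h21 : 0 < a21)
    (h41 : 0 < a41)
    (h12 : 0 < a12)
    (h32 : 0 < a32)
    (h13 : 0 < a13)
    (h43 : 0 < a43)
    (h24 : 0 < a24)
    (h34 : 0 < a34)
    (ha1 : a1 = a21 + a41)
    (ha2 : a2 = a12 + a32)
    (ha3 : a3 = a13 + a43)
    (ha4 : a4 = a24 + a34)
    (hc1 : a12 + a13 < a1)
    (hc2 : a4 < a41 + a43)
    (hc3 : a2 ≤ a21 + a24)
    (hc4 : a3 ≤ a32 + a34)
    (x1 x2 x3 x4 : MvPolynomial (Fin 4) k)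
    (hx1 : x1 = X 0) (hx2 : x2 = X 1) (hx3 : x3 = X 2) (hx4 : x4 = X 3)
    (I m : Ideal (MvPolynomial (Fin 4) k))
    (hI : I = Ideal.span {x2 ^ a12 * x3 ^ a13, x2 ^ a2, x3 ^ a3 - x2 ^ a32 * x4 ^ a34, x4 ^ a4, x3 ^ a13 * x4 ^ a24})
    (hm : m = Ideal.span {x1, x2, x3, x4})
    (g : Fin 5 → MvPolynomial (Fin 4) k)
    (hg : g = ![x2 ^ a12 * x3 ^ a13, x2 ^ a2, x3 ^ a3 - x2 ^ a32 * x4 ^ a34, x4 ^ a4, x3 ^ a13 * x4 ^ a24])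
    (φ1 : (Fin 5 → MvPolynomial (Fin 4) k) →ₗ[MvPolynomial (Fin 4) k]
      MvPolynomial (Fin 4) k)
    (hφ1 : ∀ v, φ1 v = ∑ i, v i * g i)
    (M2 : Matrix (Fin 5) (Fin 5) (MvPolynomial (Fin 4) k))
    (hM2 : M2 = !![-x4 ^ a24, 0, 0, -x2 ^ a32, -x3 ^ a43;
      0, 0, 0, x3 ^ a13, x4 ^ a34;
      0, -x4 ^ a24, 0, 0, x2 ^ a12;
      0, -x2 ^ a32, -x3 ^ a13, 0, 0;
      x2 ^ a12, x3 ^ a43, x4 ^ a34, 0, 0])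
    (M3 : Matrix (Fin 5) (Fin 1) (MvPolynomial (Fin 4) k))
    (hM3 : M3 = !![x3 ^ a3 - x2 ^ a32 * x4 ^ a34;
      -(x2 ^ a12 * x3 ^ a13);
      x2 ^ a2;
      x4 ^ a4;
      -(x3 ^ a13 * x4 ^ a24)]) :
    Function.Injective ⇑M3.mulVecLin ∧
    Function.Exact ⇑M3.mulVecLin ⇑M2.mulVecLin ∧
    Function.Exact ⇑M2.mulVecLin ⇑φ1 ∧
    LinearMap.range φ1 = I ∧
    Function.Surjective (Ideal.Quotient.mk I) ∧
    (∀ i, g i ∈ m) ∧ (∀ i j, M2 i j ∈ m) ∧ (∀ i j, M3 i j ∈ m) := by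

  subst hx1 hx2 hx3 hx4 ha2 ha3 ha4 hM2 hM3 hI hm
  have h12' : (1 : Fin 4) ≠ 2 := by decide
  have h13' : (1 : Fin 4) ≠ 3 := by decide
  have h23' : (2 : Fin 4) ≠ 3 := by decide
  have hφ : ∀ v, φ1 v = v 0 * (X 1 ^ a12 * X 2 ^ a13) + v 1 * X 1 ^ (a12 + a32) +
      v 2 * (X 2 ^ (a13 + a43) - X 1 ^ a32 * X 3 ^ a34) + v 3 * X 3 ^ (a24 + a34) +
      v 4 * (X 2 ^ a13 * X 3 ^ a24) := by
    intro v
    rw [hφ1, hg]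
    simp [Fin.sum_univ_five]
  have hgI : ∀ i, φ1 (Pi.single i 1) = g i := by
    intro i
    rw [hφ1, Finset.sum_eq_single i] <;> simp +contextual
  have hm2 : ∀ {n : ℕ}, 0 < n → (X 1 ^ n : MvPolynomial (Fin 4) k) ∈
      Ideal.span {(X 0 : MvPolynomial (Fin 4) k), X 1, X 2, X 3} := fun hn =>
    Ideal.pow_mem_of_mem _ (Ideal.subset_span (by simp)) _ hn
  have hm3 : ∀ {n : ℕ}, 0 < n → (X 2 ^ n : MvPolynomial (Fin 4) k) ∈
      Ideal.span {(X 0 : MvPolynomial (Fin 4) k), X 1, X 2, X 3} := fun hn =>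
    Ideal.pow_mem_of_mem _ (Ideal.subset_span (by simp)) _ hn
  have hm4 : ∀ {n : ℕ}, 0 < n → (X 3 ^ n : MvPolynomial (Fin 4) k) ∈
      Ideal.span {(X 0 : MvPolynomial (Fin 4) k), X 1, X 2, X 3} := fun hn =>
    Ideal.pow_mem_of_mem _ (Ideal.subset_span (by simp)) _ hn
  have hm1 := Ideal.mul_mem_right (X 2 ^ a13 : MvPolynomial (Fin 4) k) _ (hm2 h12)
  have hm5 := Ideal.mul_mem_right (X 3 ^ a24 : MvPolynomial (Fin 4) k) _ (hm3 h13)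
  have hm6 := sub_mem (hm3 (n := a13 + a43) (by omega))
    (Ideal.mul_mem_right (X 3 ^ a34 : MvPolynomial (Fin 4) k) _ (hm2 h32))
  have hm7 := hm2 (n := a12 + a32) (by omega)
  have hm8 := hm4 (n := a24 + a34) (by omega)
  refine ⟨?_, ?_, ?_, ?_, Ideal.Quotient.mk_surjective, ?_, ?_, ?_⟩
  · refine (injective_iff_map_eq_zero _).mpr fun c hc => ?_
    have := congrFun hc 2
    simp [Matrix.mulVec, dotProduct, X_ne_zero] at this
    ext1 i
    fin_cases i
    exact this
  · intro w
    constructor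
    · intro hw
      have e₀ := congrFun hw 0
      have e₁ := congrFun hw 1
      have e₂ := congrFun hw 2
      have e₃ := congrFun hw 3
      simp [Matrix.mulVec, dotProduct, Fin.sum_univ_five] at e₀ e₁ e₂ e₃
      obtain ⟨f, f₀, f₁, f₂, f₃, f₄⟩ := second_syzygy_eq (w₁ := w 0) (w₂ := w 1) (w₃ := w 2)
        (w₄ := w 3) (w₅ := w 4) (p := a12) (q := a32) (r := a13) (s := a43) (t := a24)
        (u := a34) h12' h13'
        (by linear_combination e₀) (by linear_combination e₁) (by linear_combination e₂)
        (by linear_combination e₃)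
      refine ⟨fun _ => f, ?_⟩
      ext1 i
      fin_cases i <;> simp [Matrix.mulVec, dotProduct, f₀, f₁, f₂, f₃, f₄]
    · rintro ⟨c, rfl⟩
      ext1 i
      fin_cases i <;> simp [Matrix.mulVec, dotProduct, Fin.sum_univ_five] <;> ring
  · intro v
    rw [hφ]
    constructor
    · intro hv
      obtain ⟨w₁, w₂, w₃, w₄, w₅, e₁, e₂, e₃, e₄, e₅⟩ :=
        first_syzygy_eq h12' h13' h23' h32 hv
      refine ⟨![w₁, w₂, w₃, w₄, w₅], ?_⟩
      ext1 i
      fin_cases i <;>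
        simp [Matrix.mulVec, dotProduct, Fin.sum_univ_five, e₁, e₂, e₃, e₄, e₅]
    · rintro ⟨w, rfl⟩
      simp [Matrix.mulVec, dotProduct, Fin.sum_univ_five]
      ring
  · apply le_antisymm
    · rintro _ ⟨v, rfl⟩
      rw [hφ]
      refine add_mem (add_mem (add_mem (add_mem ?_ ?_) ?_) ?_) ?_ <;>
        exact Ideal.mul_mem_left _ _ (Ideal.subset_span (by simp))
    · refine Ideal.span_le.mpr ?_
      rintro _ (rfl | rfl | rfl | rfl | rfl)
      · exact ⟨_, (hgI 0).trans (by simp [hg])⟩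
      · exact ⟨_, (hgI 1).trans (by simp [hg])⟩
      · exact ⟨_, (hgI 2).trans (by simp [hg])⟩
      · exact ⟨_, (hgI 3).trans (by simp [hg])⟩
      · exact ⟨_, (hgI 4).trans (by simp [hg])⟩
  · intro i
    rw [hg]
    fin_cases i
    exacts [hm1, hm7, hm6, hm8, hm5]
  · have z := Submodule.zero_mem
      (Ideal.span {(X 0 : MvPolynomial (Fin 4) k), X 1, X 2, X 3})
    intro i j
    fin_cases i <;> fin_cases j
    exacts [neg_mem (hm4 h24), z, z, neg_mem (hm2 h32), neg_mem (hm3 h43),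
      z, z, z, hm3 h13, hm4 h34,
      z, neg_mem (hm4 h24), z, z, hm2 h12,
      z, neg_mem (hm2 h32), neg_mem (hm3 h13), z, z,
      hm2 h12, hm3 h43, hm4 h34, z, z]
  · intro i j
    fin_cases i <;> fin_cases j
    exacts [hm6, neg_mem hm1, hm7, hm8, neg_mem hm5]
end

section
/- Let I be the ideal of R generated by x2^{a12}x4^{a14}, x2^{a2}, x3^{a3}, x4^{a4}, x3^{a23}x4^{a14}. Then the sequence 0 → R^2 →(φ3) R^6 →(φ2) R^5 →(φ1) R → R/I → 0 is exact, and it is a minimal free resolution of R/I. Here φ1 = (x2^{a12}x4^{a14}, x2^{a2}, x3^{a3}, x4^{a4}, x3^{a23}x4^{a14}); φ2 is the 5×6 matrix with rows (0, 0, x3^{a23}, x4^{a34}, x2^{a42}, 0), (0, −x3^{a3}, 0, 0, −x4^{a14}, 0), (x4^{a14}, x2^{a2}, 0, 0, 0, 0), (0, 0, 0, −x2^{a12}, 0, −x3^{a23}), (−x3^{a43}, 0, −x2^{a12}, 0, 0, x4^{a34}); and φ3 is the 6×2 matrix with rows (x2^{a2}, 0), (−x4^{a14}, 0), (−x2^{a42}x3^{a43},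 x4^{a34}), (0, −x3^{a23}), (x3^{a3}, 0), (0, x2^{a12}). -/
open MvPolynomial Matrix

/-- A variable not occurring in the generators of a monomial ideal is a nonzerodivisor modulo that
ideal. -/
theorem MvPolynomial.mem_span_monomial_of_X_pow_mul_mem {σ k : Type*} [CommSemiring k]
    {S : Set (σ →₀ ℕ)} {i : σ} (hS : ∀ s ∈ S, s i = 0) (a : ℕ) {p : MvPolynomial σ k}
    (h : X i ^ a * p ∈ Ideal.span ((fun s => monomial s (1 : k)) '' S)) :
    p ∈ Ideal.span ((fun s => monomial s (1 : k)) '' S) := by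
  classical
  rw [mem_ideal_span_monomial_image] at h ⊢
  intro m hm
  have hmem : Finsupp.single i a + m ∈ (X i ^ a * p).support := by
    rw [mem_support_iff, X_pow_eq_monomial, coeff_monomial_mul, one_mul]
    exact mem_support_iff.mp hm
  obtain ⟨s, hs, hle⟩ := h _ hmem
  refine ⟨s, hs, fun j => ?_⟩
  rcases eq_or_ne j i with rfl | hj
  · simp [hS s hs]
  · simpa [Finsupp.single_eq_of_ne hj] using hle j

theorem MvPolynomial.exists_eq_add_of_X_pow_syzygy {σ k : Type*} [CommRing k] {i j l : σ}
    (hj : j ≠ i) (hl : l ≠ i) (a b c : ℕ) {p q r : MvPolynomial σ k}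
    (h : X i ^ a * p + X j ^ b * q + X l ^ c * r = 0) :
    ∃ s t, p = s * X j ^ b + t * X l ^ c := by
  have hspan : Ideal.span ((fun s => monomial s (1 : k)) ''
      {Finsupp.single j b, Finsupp.single l c}) = Ideal.span {X j ^ b, X l ^ c} := by
    simp only [Set.image_pair, X_pow_eq_monomial]
  have hp := mem_span_monomial_of_X_pow_mul_mem (k := k) (i := i) (p := p)
    (S := {Finsupp.single j b, Finsupp.single l c})
    (by rintro s (rfl | rfl) <;> simp [hj.symm, hl.symm]) a (by
      rw [hspan, Ideal.mem_span_pair]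
      exact ⟨-q, -r, by linear_combination -h⟩)
  rw [hspan, Ideal.mem_span_pair] at hp
  obtain ⟨s, t, hst⟩ := hp
  exact ⟨s, t, hst.symm⟩

theorem MvPolynomial.exists_eq_mul_of_X_pow_syzygy {σ k : Type*} [CommRing k] {i j : σ}
    (hj : j ≠ i) (a b : ℕ) {p q : MvPolynomial σ k} (h : X i ^ a * p + X j ^ b * q = 0) :
    ∃ s, p = s * X j ^ b := by
  obtain ⟨s, t, hst⟩ := exists_eq_add_of_X_pow_syzygy hj hj a b b (p := p) (q := q) (r := 0)
    (by simpa using h)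
  exact ⟨s + t, by rw [hst, add_mul]⟩

section Complex

variable {R : Type*} [CommRing R] (A B C D E F : R)

/-- The first syzygies of the products `A * E`, `A * B`, `C * D`, `E * F`, `C * E`. -/
def firstSyzygyMatrix : Matrix (Fin 5) (Fin 6) R :=
  !![0, 0, C, F, B, 0;
    0, -(C * D), 0, 0, -E, 0;
    E, A * B, 0, 0, 0, 0;
    0, 0, 0, -A, 0, -C;
    -D, 0, -A, 0, 0, F]

/-- The second syzygies of the products `A * E`, `A * B`, `C * D`, `E * F`, `C * E`. -/
def secondSyzygyMatrix : Matrix (Fin 6) (Fin 2) R :=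
  !![A * B, 0;
    -E, 0;
    -(B * D), F;
    0, -C;
    C * D, 0;
    0, A]

theorem firstSyzygyMatrix_mulVec (u : Fin 6 → R) :
    firstSyzygyMatrix A B C D E F *ᵥ u =
      ![C * u 2 + F * u 3 + B * u 4, -(C * D * u 1) - E * u 4, E * u 0 + A * B * u 1,
        -(A * u 3) - C * u 5, -(D * u 0) - A * u 2 + F * u 5] := by
  ext i
  fin_cases i <;> simp [firstSyzygyMatrix, mulVec, dotProduct, Fin.sum_univ_succ] <;> ring

theorem secondSyzygyMatrix_mulVec (w : Fin 2 → R) :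
    secondSyzygyMatrix A B C D E F *ᵥ w =
      ![A * B * w 0, -(E * w 0), -(B * D * w 0) + F * w 1, -(C * w 1), C * D * w 0, A * w 1] := by
  ext i
  fin_cases i <;> simp [secondSyzygyMatrix, mulVec, dotProduct, Fin.sum_univ_succ]

variable {A B C D E F}

theorem secondSyzygyMatrix_mulVecLin_injective [IsDomain R] (hE : E ≠ 0) (hA : A ≠ 0) :
    Function.Injective (secondSyzygyMatrix A B C D E F).mulVecLin := by
  rw [injective_iff_map_eq_zero]
  intro w hw
  rw [mulVecLin_apply, secondSyzygyMatrix_mulVec] at hw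
  have h1 := congrFun hw 1
  have h5 := congrFun hw 5
  simp [hE] at h1
  simp [hA] at h5
  ext i
  fin_cases i <;> simp [h1, h5]

theorem exact_secondSyzygyMatrix_firstSyzygyMatrix [IsDomain R]
    (hA : A ≠ 0) (hB : B ≠ 0) (hC : C ≠ 0) (hE : E ≠ 0)
    (hABE : ∀ p q, E * p + A * B * q = 0 → ∃ s, p = s * (A * B))
    (hAC : ∀ p q, C * p + A * q = 0 → ∃ s, p = s * A) :
    Function.Exact (secondSyzygyMatrix A B C D E F).mulVecLin
      (firstSyzygyMatrix A B C D E F).mulVecLin := by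
  intro u
  simp only [mulVecLin_apply, Set.mem_range]
  constructor
  · intro hu
    rw [firstSyzygyMatrix_mulVec] at hu
    have h0 : C * u 2 + F * u 3 + B * u 4 = 0 := congrFun hu 0
    have h1 : -(C * D * u 1) - E * u 4 = 0 := congrFun hu 1
    have h2 : E * u 0 + A * B * u 1 = 0 := congrFun hu 2
    have h3 : -(A * u 3) - C * u 5 = 0 := congrFun hu 3
    obtain ⟨t, h4⟩ := hABE _ _ h2
    obtain ⟨s, h5⟩ := hAC (u 5) (u 3) (by linear_combination -h3)
    have h6 : u 1 = -(E * t) :=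
      mul_left_cancel₀ (mul_ne_zero hA hB) (by linear_combination h2 - E * h4)
    have h7 : u 4 = C * D * t :=
      mul_left_cancel₀ hE (by linear_combination -h1 - C * D * h6)
    have h8 : u 3 = -(C * s) :=
      mul_left_cancel₀ hA (by linear_combination -h3 - C * h5)
    have h9 : u 2 = -(B * D * t) + F * s :=
      mul_left_cancel₀ hC (by linear_combination h0 - F * h8 - B * h7)
    refine ⟨![t, s], ?_⟩
    rw [secondSyzygyMatrix_mulVec]
    ext i
    fin_cases i <;> simp [h4, h5, h6, h7, h8, h9, mul_comm]
  · rintro ⟨w, rfl⟩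
    rw [firstSyzygyMatrix_mulVec, secondSyzygyMatrix_mulVec]
    ext i
    fin_cases i <;> simp <;> ring

theorem exact_firstSyzygyMatrix [IsDomain R] (hE : E ≠ 0) (hC : C ≠ 0)
    (hABCDE : ∀ p q r, A * B * p + C * D * q + E * r = 0 → ∃ s t, p = s * (C * D) + t * E)
    (hFAC : ∀ p q r, F * p + A * q + C * r = 0 → ∃ s t, p = s * A + t * C)
    (hCDE : ∀ p q, C * D * p + E * q = 0 → ∃ s, p = s * E)
    (hAC : ∀ p q, A * p + C * q = 0 → ∃ s, p = s * C)
    {φ : (Fin 5 → R) →ₗ[R] R}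
    (hφ : ∀ v, φ v = ∑ i, v i * ![A * E, A * B, C * D, E * F, C * E] i) :
    Function.Exact (firstSyzygyMatrix A B C D E F).mulVecLin φ := by
  intro v
  simp only [mulVecLin_apply, Set.mem_range, firstSyzygyMatrix_mulVec, hφ, Fin.sum_univ_five]
  constructor
  · intro hv
    simp at hv
    obtain ⟨s, t, h1⟩ := hABCDE (v 1) (v 2) (v 0 * A + v 3 * F + v 4 * C)
      (by linear_combination hv)
    obtain ⟨u, h2⟩ := hCDE (v 2 + s * (A * B)) (v 0 * A + v 3 * F + v 4 * C + t * (A * B))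
      (by linear_combination hv - A * B * h1)
    have h0 : (v 0 + t * B) * A + v 3 * F + (v 4 + u * D) * C = 0 :=
      mul_left_cancel₀ hE (by linear_combination hv - A * B * h1 - C * D * h2)
    obtain ⟨a, b, h3⟩ := hFAC (v 3) (v 0 + t * B) (v 4 + u * D) (by linear_combination h0)
    obtain ⟨c, h4⟩ := hAC (v 0 + t * B + a * F) (v 4 + u * D + b * F)
      (by linear_combination h0 - F * h3)
    have h5 : v 4 + u * D + b * F = -(A * c) :=
      mul_left_cancel₀ hC (by linear_combination h0 - F * h3 - A * h4)
    refine ⟨![u, -s, c, -a, -t, -b], ?_⟩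
    ext i
    fin_cases i
    · simp; linear_combination -h4
    · simp; linear_combination -h1
    · simp; linear_combination -h2
    · simp; linear_combination -h3
    · simp; linear_combination -h5
  · rintro ⟨w, rfl⟩
    simp
    ring

theorem firstSyzygyMatrix_mem {J : Ideal R} (hA : A ∈ J) (hB : B ∈ J) (hC : C ∈ J) (hD : D ∈ J)
    (hE : E ∈ J) (hF : F ∈ J) (i : Fin 5) (j : Fin 6) :
    firstSyzygyMatrix A B C D E F i j ∈ J := by
  fin_cases i <;> fin_cases j <;> simp [firstSyzygyMatrix, Ideal.mul_mem_right, *]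

theorem secondSyzygyMatrix_mem {J : Ideal R} (hA : A ∈ J) (hB : B ∈ J) (hC : C ∈ J)
    (hE : E ∈ J) (hF : F ∈ J) (i : Fin 6) (j : Fin 2) :
    secondSyzygyMatrix A B C D E F i j ∈ J := by
  fin_cases i <;> fin_cases j <;> simp [secondSyzygyMatrix, Ideal.mul_mem_right, *]

end Complex

theorem gorenstein_tangent_cone_resolution_case_3a_stmt10
    (k : Type*) [Field k]
    (a21 a31 a12 a42 a23 a43 a14 a34 a1 a2 a3 a4 : ℕ)
    (h21 : 0 < a21)
    (h31 : 0 < a31)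
    (h12 : 0 < a12)
    (h42 : 0 < a42)
    (h23 : 0 < a23)
    (h43 : 0 < a43)
    (h14 : 0 < a14)
    (h34 : 0 < a34)
    (ha1 : a1 = a21 + a31)
    (ha2 : a2 = a12 + a42)
    (ha3 : a3 = a23 + a43)
    (ha4 : a4 = a14 + a34)
    (hc1 : a12 + a14 < a1)
    (hc2 : a4 < a42 + a43)
    (hc3 : a2 ≤ a21 + a23)
    (hc4 : a3 ≤ a31 + a34)
    (x1 x2 x3 x4 : MvPolynomial (Fin 4) k)
    (hx1 : x1 = X 0) (hx2 : x2 = X 1) (hx3 : x3 = X 2) (hx4 : x4 = X 3)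
    (I m : Ideal (MvPolynomial (Fin 4) k))
    (hI : I = Ideal.span {x2 ^ a12 * x4 ^ a14, x2 ^ a2, x3 ^ a3, x4 ^ a4, x3 ^ a23 * x4 ^ a14})
    (hm : m = Ideal.span {x1, x2, x3, x4})
    (g : Fin 5 → MvPolynomial (Fin 4) k)
    (hg : g = ![x2 ^ a12 * x4 ^ a14, x2 ^ a2, x3 ^ a3, x4 ^ a4, x3 ^ a23 * x4 ^ a14])
    (φ1 : (Fin 5 → MvPolynomial (Fin 4) k) →ₗ[MvPolynomial (Fin 4) k]
      MvPolynomial (Fin 4) k)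
    (hφ1 : ∀ v, φ1 v = ∑ i, v i * g i)
    (M2 : Matrix (Fin 5) (Fin 6) (MvPolynomial (Fin 4) k))
    (hM2 : M2 = !![0, 0, x3 ^ a23, x4 ^ a34, x2 ^ a42, 0;
      0, -x3 ^ a3, 0, 0, -x4 ^ a14, 0;
      x4 ^ a14, x2 ^ a2, 0, 0, 0, 0;
      0, 0, 0, -x2 ^ a12, 0, -x3 ^ a23;
      -x3 ^ a43, 0, -x2 ^ a12, 0, 0, x4 ^ a34])
    (M3 : Matrix (Fin 6) (Fin 2) (MvPolynomial (Fin 4) k))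
    (hM3 : M3 = !![x2 ^ a2, 0;
      -x4 ^ a14, 0;
      -(x2 ^ a42 * x3 ^ a43), x4 ^ a34;
      0, -x3 ^ a23;
      x3 ^ a3, 0;
      0, x2 ^ a12]) :
    Function.Injective ⇑M3.mulVecLin ∧
    Function.Exact ⇑M3.mulVecLin ⇑M2.mulVecLin ∧
    Function.Exact ⇑M2.mulVecLin ⇑φ1 ∧
    LinearMap.range φ1 = I ∧
    Function.Surjective (Ideal.Quotient.mk I) ∧
    (∀ i, g i ∈ m) ∧ (∀ i j, M2 i j ∈ m) ∧ (∀ i j, M3 i j ∈ m) := by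
  subst hI hm hg hM2 hM3 ha2 ha3 ha4 hx1 hx2 hx3 hx4
  have hmem {i : Fin 4} {n : ℕ} (hn : 0 < n) :
      (X i ^ n : MvPolynomial (Fin 4) k) ∈ Ideal.span {X 0, X 1, X 2, X 3} :=
    Ideal.pow_mem_of_mem _ (Ideal.subset_span (by fin_cases i <;> simp)) n hn
  have hne (i : Fin 4) (n : ℕ) : (X i ^ n : MvPolynomial (Fin 4) k) ≠ 0 :=
    pow_ne_zero n (X_ne_zero i)
  refine ⟨?_, ?_, ?_, ?_, Ideal.Quotient.mk_surjective, ?_, ?_, ?_⟩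
  · simp only [pow_add]
    exact secondSyzygyMatrix_mulVecLin_injective (hne 3 a14) (hne 1 a12)
  · simp only [pow_add]
    refine exact_secondSyzygyMatrix_firstSyzygyMatrix (hne 1 a12) (hne 1 a42)
      (hne 2 a23) (hne 3 a14) ?_ ?_
    · intro p q
      rw [← pow_add]
      exact exists_eq_mul_of_X_pow_syzygy (by decide) _ _
    · intro p q
      exact exists_eq_mul_of_X_pow_syzygy (by decide) _ _
  · simp only [pow_add] at hφ1 ⊢
    refine exact_firstSyzygyMatrix (hne 3 a14) (hne 2 a23) ?_ ?_ ?_ ?_ hφ1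
    · intro p q r
      simp only [← pow_add]
      exact exists_eq_add_of_X_pow_syzygy (by decide) (by decide) _ _ _
    · intro p q r
      exact exists_eq_add_of_X_pow_syzygy (by decide) (by decide) _ _ _
    · intro p q
      rw [← pow_add]
      exact exists_eq_mul_of_X_pow_syzygy (by decide) _ _
    · intro p q
      exact exists_eq_mul_of_X_pow_syzygy (by decide) _ _
  · ext p
    rw [show ({X 1 ^ a12 * X 3 ^ a14, X 1 ^ (a12 + a42), X 2 ^ (a23 + a43), X 3 ^ (a14 + a34),
        X 2 ^ a23 * X 3 ^ a14} : Set (MvPolynomial (Fin 4) k)) =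
        Set.range ![X 1 ^ a12 * X 3 ^ a14, X 1 ^ (a12 + a42), X 2 ^ (a23 + a43), X 3 ^ (a14 + a34),
          X 2 ^ a23 * X 3 ^ a14] by
        simp only [range_cons, range_empty, Set.union_empty, Set.singleton_union],
      Ideal.mem_span_range_iff_exists_fun]
    simp only [LinearMap.mem_range, hφ1]
  · intro i
    simp only [pow_add]
    fin_cases i <;> simp [Ideal.mul_mem_right, *]
  · simp only [pow_add]
    exact firstSyzygyMatrix_mem (hmem h12) (hmem h42) (hmem h23) (hmem h43) (hmem h14) (hmem h34)
  · simp only [pow_add]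
    exact secondSyzygyMatrix_mem (hmem h12) (hmem h42) (hmem h23) (hmem h14) (hmem h34)
end
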